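/- arXiv:2601.20249 — 2 statements merged into one kernel-verified Lean document; each statement's English description precedes it below -/
import Mathlib

section
/- Let R be a ring satisfying: (1) R is a filtered colimit R = colim R_λ of a family of subrings {R_λ}_{λ∈Λ} of R; (2) each R_λ is isomorphic to its opposite ring R_λ^op; (3) each R_λ is left ℵ₀-noetherian; (4) R is flat as a right R_λ-module and R_λ is a direct summand of R as a left R_λ-module, for every λ. Then l.spli(R) ≤ l.silp(R). -/
open TensorProduct

universe u

noncomputable section GorensteinCore

/-- `ProjDimLE R n M` : the left `R`-module `M` has a projective resolution of length `≤ n`. -/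
def ProjDimLE (R : Type u) [Ring R] : ℕ → (M : Type u) → [AddCommGroup M] → [Module R M] → Prop
  | 0, M, _, _ => Module.Projective R M
  | (n+1), M, _, _ => Module.Projective R M ∨
      ∃ (P : ModuleCat.{u} R) (f : P →ₗ[R] M), Module.Projective R P ∧
      Function.Surjective f ∧ ProjDimLE R n (LinearMap.ker f)

/-- The projective dimension of a module, as an element of `ℕ∞` (`⊤` = infinite). -/
def projDim (R : Type u) [Ring R] (M : Type u) [AddCommGroup M] [Module R M] : ℕ∞ :=
  sInf {n : ℕ∞ | ∃ m : ℕ, n = (m : ℕ∞) ∧ ProjDimLE R m M}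

/-- A module is Gorenstein projective if it is a syzygy of a totally acyclic complex of
projective modules. -/
def IsGorensteinProjective (R : Type u) [Ring R] (M : Type u) [AddCommGroup M] [Module R M] :
    Prop :=
  ∃ (P : ℤ → ModuleCat.{u} R) (d : ∀ i : ℤ, P (i+1) →ₗ[R] P i),
    (∀ i, Module.Projective R (P i)) ∧
    (∀ i, LinearMap.range (d (i+1)) = LinearMap.ker (d i)) ∧
    (∀ (Q : ModuleCat.{u} R), Module.Projective R Q →
      ∀ (i : ℤ) (f : P (i+1) →ₗ[R] Q), f.comp (d (i+1)) = 0 →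
        ∃ g : P i →ₗ[R] Q, g.comp (d i) = f) ∧
    Nonempty (M ≃ₗ[R] LinearMap.ker (d 0))

/-- `GProjDimLE R n M` : `M` has a Gorenstein projective resolution of length `≤ n`. -/
def GProjDimLE (R : Type u) [Ring R] : ℕ → (M : Type u) → [AddCommGroup M] → [Module R M] → Prop
  | 0, M, _, _ => IsGorensteinProjective R M
  | (n+1), M, _, _ => IsGorensteinProjective R M ∨
      ∃ (G : ModuleCat.{u} R) (f : G →ₗ[R] M), IsGorensteinProjective R G ∧
      Function.Surjective f ∧ GProjDimLE R n (LinearMap.ker f)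

/-- The Gorenstein projective dimension of a module, as an element of `ℕ∞`. -/
def gProjDim (R : Type u) [Ring R] (M : Type u) [AddCommGroup M] [Module R M] : ℕ∞ :=
  sInf {n : ℕ∞ | ∃ m : ℕ, n = (m : ℕ∞) ∧ GProjDimLE R m M}

/-- The (left) Gorenstein global dimension of a ring `R`. -/
def lGgldim (R : Type u) [Ring R] : ℕ∞ :=
  ⨆ M : ModuleCat.{u} R, gProjDim R M

/-- The (left) global dimension of a ring `R`. -/
def lgldim (R : Type u) [Ring R] : ℕ∞ :=
  ⨆ M : ModuleCat.{u} R, projDim R M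

/-- `InjDimLE R n M` : the left `R`-module `M` has an injective resolution of length `≤ n`. -/
def InjDimLE (R : Type u) [Ring R] : ℕ → (M : Type u) → [AddCommGroup M] → [Module R M] → Prop
  | 0, M, _, _ => Module.Injective R M
  | (n+1), M, _, _ => Module.Injective R M ∨
      ∃ (I : ModuleCat.{u} R) (f : M →ₗ[R] I), Module.Injective R I ∧
      Function.Injective f ∧ InjDimLE R n (I ⧸ LinearMap.range f)

/-- The injective dimension of a module, as an element of `ℕ∞`. -/
def injDim (R : Type u) [Ring R] (M : Type u) [AddCommGroup M] [Module R M] : ℕ∞ :=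
  sInf {n : ℕ∞ | ∃ m : ℕ, n = (m : ℕ∞) ∧ InjDimLE R m M}

/-- `silp R` : the supremum of the injective dimensions of projective left `R`-modules. -/
def silp (R : Type u) [Ring R] : ℕ∞ :=
  ⨆ (M : ModuleCat.{u} R) (_ : Module.Projective R M), injDim R M

/-- `spli R` : the supremum of the projective dimensions of injective left `R`-modules. -/
def spli (R : Type u) [Ring R] : ℕ∞ :=
  ⨆ (M : ModuleCat.{u} R) (_ : Module.Injective R M), projDim R M

end GorensteinCore
noncomputable section HopfCore

variable (k : Type u) [CommRing k] (H : Type u) [Ring H] [HopfAlgebra k H]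

/-- The trivial left `H`-module structure on `k`, given by the counit. -/
def trivModule : Module H k :=
  Module.compHom k ((Bialgebra.counitAlgHom k H : H →ₐ[k] k) : H →+* k)

/-- The trivial left `H`-module `εk`, as an object of `ModuleCat H`. -/
def trivMod : ModuleCat.{u} H :=
  @ModuleCat.of H _ k _ (trivModule k H)

/-- The counit of `H`, as a ring homomorphism out of `Hᵐᵒᵖ`. -/
def counitOp : Hᵐᵒᵖ →+* k :=
  RingHom.fromOpposite ((Bialgebra.counitAlgHom k H : H →ₐ[k] k) : H →+* k)
    (fun _ _ => mul_comm _ _)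

/-- The trivial right `H`-module structure on `k` (as a left `Hᵐᵒᵖ`-module). -/
def trivModuleOp : Module Hᵐᵒᵖ k :=
  Module.compHom k (counitOp k H)

/-- The trivial right `H`-module `k_ε`, as an object of `ModuleCat Hᵐᵒᵖ`. -/
def trivModOp : ModuleCat.{u} Hᵐᵒᵖ :=
  @ModuleCat.of Hᵐᵒᵖ _ k _ (trivModuleOp k H)

section TensorAction

variable (M N : Type u) [AddCommGroup M] [Module k M] [Module H M]
  [IsScalarTower k H M] [SMulCommClass k H M]
  [AddCommGroup N] [Module k N] [Module H N] [IsScalarTower k H N] [SMulCommClass k H N]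

/-- The representation of `H` on a left `H`-module `M`, as an algebra morphism to
`End_k(M)`. -/
def hRep : H →ₐ[k] Module.End k M :=
  (Algebra.lsmul k k M : H →ₐ[k] Module.End k M)

/-- The representation of `H` on `M ⊗[k] N` given by the comultiplication of `H`:
`h • (m ⊗ n) = ∑ h₁ • m ⊗ h₂ • n`. -/
def tensorRep : H →ₐ[k] Module.End k (M ⊗[k] N) :=
  ((Module.endTensorEndAlgHom (R := k) (S := k) (A := k) (M := M) (N := N)).comp
    (Algebra.TensorProduct.map (hRep k H M) (hRep k H N))).comp
    (Bialgebra.comulAlgHom k H)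

/-- The diagonal left `H`-module structure on `M ⊗[k] N`:
`h • (m ⊗ n) = ∑ h₁ • m ⊗ h₂ • n`. -/
def tensorModule : Module H (M ⊗[k] N) :=
  Module.compHom (M ⊗[k] N)
    ((tensorRep k H M N).toRingHom : H →+* Module.End k (M ⊗[k] N))

/-- The tensor product `M ⊗[k] N` with its diagonal left `H`-module structure, as an
object of `ModuleCat H`. -/
def tensorMod : ModuleCat.{u} H :=
  @ModuleCat.of H _ (M ⊗[k] N) _ (tensorModule k H M N)

end TensorAction

end HopfCore


/-- A ring is left `ℵ₀`-noetherian if every left ideal is countably generated. -/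
def IsLeftAleph0Noetherian (R : Type u) [Ring R] : Prop :=
  ∀ I : Submodule R R, ∃ s : Set R, s.Countable ∧ Submodule.span R s = I

/-- `R` is flat as a right module over the subring `s`, expressed through the equational
criterion of flatness. -/
def RightFlatOverSubring (R : Type u) [Ring R] (s : Subring R) : Prop :=
  ∀ (n : ℕ) (a : Fin n → s) (b : Fin n → R),
    (∑ i, b i * ((a i : s) : R)) = 0 →
    ∃ (m : ℕ) (c : Fin m → R) (d : Fin m → Fin n → s),
      (∀ i, b i = ∑ j, c j * ((d j i : s) : R)) ∧ ∀ j, (∑ i, (d j i) * a i) = 0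

section ExtVanishing

variable {R : Type u} [Ring R]

/-- `ExtOneVanishes R M N` : every extension of `M` by `N` splits. It is expressed by saying that
a linear map into `N` from the kernel of a surjection onto `M` extends to the whole source. -/
def ExtOneVanishes (R : Type u) [Ring R] (M N : Type u) [AddCommGroup M] [Module R M]
    [AddCommGroup N] [Module R N] : Prop :=
  ∀ (X : Type u) [AddCommGroup X] [Module R X] (f : X →ₗ[R] M), Function.Surjective f →
    ∀ g : LinearMap.ker f →ₗ[R] N, ∃ h : X →ₗ[R] N, ∀ x : LinearMap.ker f, h x = g x

lemma LinearMap.exists_factor_of_surjective {X M N : Type*} [AddCommGroup X] [Module R X]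
    [AddCommGroup M] [Module R M] [AddCommGroup N] [Module R N] (f : X →ₗ[R] M)
    (hf : Function.Surjective f) (g : X →ₗ[R] N) (h : ∀ x, f x = 0 → g x = 0) :
    ∃ k : M →ₗ[R] N, ∀ x, k (f x) = g x := by
  refine ⟨((LinearMap.ker f).liftQ g fun x hx => h x hx) ∘ₗ
    (f.quotKerEquivOfSurjective hf).symm.toLinearMap, fun x => ?_⟩
  have : (f.quotKerEquivOfSurjective hf).symm (f x) = (LinearMap.ker f).mkQ x := by
    rw [LinearEquiv.symm_apply_eq]; rfl
  simp only [LinearMap.comp_apply, LinearEquiv.coe_coe, this]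
  rfl

lemma LinearMap.exists_factor_of_injective {X M N : Type*} [AddCommGroup X] [Module R X]
    [AddCommGroup M] [Module R M] [AddCommGroup N] [Module R N] (i : N →ₗ[R] M)
    (hi : Function.Injective i) (g : X →ₗ[R] M) (h : ∀ x, ∃ y, i y = g x) :
    ∃ k : X →ₗ[R] N, ∀ x, i (k x) = g x := by
  choose y hy using h
  exact ⟨⟨⟨y, fun a b => hi (by simp [hy])⟩, fun r a => hi (by simp [hy])⟩, hy⟩

variable {M N P J C : Type u} [AddCommGroup M] [Module R M] [AddCommGroup N] [Module R N]
  [AddCommGroup P] [Module R P] [AddCommGroup J] [Module R J] [AddCommGroup C] [Module R C]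

lemma ExtOneVanishes.of_injective (hJ : Module.Injective R J) : ExtOneVanishes R M J :=
  fun _ _ _ _ _ g => hJ.out _ (Submodule.subtype_injective _) g

lemma ExtOneVanishes.of_projective (hP : Module.Projective R P) : ExtOneVanishes R P N := by
  intro X _ _ f hf g
  obtain ⟨s, hs⟩ := Module.projective_lifting_property f LinearMap.id hf
  have hs' : ∀ y, f (s y) = y := fun y => LinearMap.congr_fun hs y
  refine ⟨g ∘ₗ (LinearMap.id - s ∘ₗ f).codRestrict (LinearMap.ker f) fun x => by simp [hs'],
    fun x => ?_⟩
  simp only [LinearMap.comp_apply]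
  congr 1
  ext
  simp

/-- Vanishing of extensions passes to retracts of the coefficient module. -/
lemma ExtOneVanishes.of_retract (h : ExtOneVanishes R M N) (i : C →ₗ[R] N) (r : N →ₗ[R] C)
    (hri : ∀ c, r (i c) = c) : ExtOneVanishes R M C := by
  intro X _ _ f hf g
  obtain ⟨k, hk⟩ := h X f hf (i ∘ₗ g)
  exact ⟨r ∘ₗ k, fun x => by simp [hk, hri]⟩

lemma ExtOneVanishes.of_linearEquiv (h : ExtOneVanishes R M N) (e : M ≃ₗ[R] P) :
    ExtOneVanishes R P N := by
  intro X _ _ f hf g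
  have hk : ∀ x, x ∈ LinearMap.ker (e.symm.toLinearMap ∘ₗ f) → x ∈ LinearMap.ker f := by simp
  obtain ⟨k, hk⟩ := h X (e.symm.toLinearMap ∘ₗ f) (e.symm.surjective.comp hf)
    (g ∘ₗ Submodule.inclusion hk)
  exact ⟨k, fun x => (hk ⟨x, by simp⟩).trans (by rfl)⟩

/-- Linear maps extend from a submodule when the quotient has no extensions by the target. -/
lemma ExtOneVanishes.exists_extension {L : Submodule R P} (h : ExtOneVanishes R (P ⧸ L) N)
    (g : L →ₗ[R] N) : ∃ k : P →ₗ[R] N, ∀ x : L, k x = g x := by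
  obtain ⟨k, hk⟩ := h P L.mkQ L.mkQ_surjective (g ∘ₗ (LinearEquiv.ofEq _ _ L.ker_mkQ).toLinearMap)
  exact ⟨k, fun x => hk ⟨x, by simp⟩⟩

/-- Vanishing of extensions can be tested on one projective presentation. -/
lemma extOneVanishes_iff_extend (hP : Module.Projective R P) (f : P →ₗ[R] M)
    (hf : Function.Surjective f) :
    ExtOneVanishes R M N ↔
      ∀ g : LinearMap.ker f →ₗ[R] N, ∃ h : P →ₗ[R] N, ∀ x : LinearMap.ker f, h x = g x := by
  refine ⟨fun h => h P f hf, fun h X _ _ f' hf' g => ?_⟩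
  obtain ⟨t, ht⟩ := Module.projective_lifting_property f' f hf'
  have ht' : ∀ y, f' (t y) = f y := fun y => LinearMap.congr_fun ht y
  let t' : LinearMap.ker f →ₗ[R] LinearMap.ker f' :=
    (t ∘ₗ (LinearMap.ker f).subtype).codRestrict _ fun x => by simp [ht']
  obtain ⟨k, hk⟩ := h (g ∘ₗ t')
  obtain ⟨l, hl⟩ := LinearMap.exists_factor_of_surjective
    (t.coprod (LinearMap.ker f').subtype) (fun x => by
      obtain ⟨p, hp⟩ := hf (f' x)
      exact ⟨(p, ⟨x - t p, by simp [ht', hp]⟩), by simp⟩) (k.coprod g) (by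
      rintro ⟨p, a⟩ hpa
      simp only [LinearMap.coprod_apply, Submodule.subtype_apply] at hpa ⊢
      have hp : p ∈ LinearMap.ker f := by
        have := congrArg f' hpa
        simpa [ht'] using this
      rw [hk ⟨p, hp⟩, LinearMap.comp_apply, ← map_add]
      convert map_zero g
      ext
      exact hpa)
  exact ⟨l, fun x => by simpa using hl (0, x)⟩

/-- Vanishing of extensions can be tested on one injective copresentation. -/
lemma extOneVanishes_iff_lift (hJ : Module.Injective R J) (i : N →ₗ[R] J)
    (hi : Function.Injective i) (p : J →ₗ[R] C) (hp : Function.Surjective p)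
    (hip : Function.Exact i p) :
    ExtOneVanishes R M N ↔ ∀ g : M →ₗ[R] C, ∃ h : M →ₗ[R] J, ∀ x, p (h x) = g x := by
  constructor
  · intro h g
    let X : Submodule R (M × J) :=
      LinearMap.eqLocus (g ∘ₗ LinearMap.fst R M J) (p ∘ₗ LinearMap.snd R M J)
    let f : X →ₗ[R] M := LinearMap.fst R M J ∘ₗ X.subtype
    have hX : ∀ x : X, g (x : M × J).1 = p (x : M × J).2 := fun x => x.2
    have hf : Function.Surjective f := fun m => by
      obtain ⟨j, hj⟩ := hp (g m)
      exact ⟨⟨(m, j), hj.symm⟩, rfl⟩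
    obtain ⟨a, ha⟩ := LinearMap.exists_factor_of_injective i hi
      (LinearMap.snd R M J ∘ₗ X.subtype ∘ₗ (LinearMap.ker f).subtype) (fun x : LinearMap.ker f => by
        apply (hip _).1
        have hx : x.1.1.1 = 0 := x.2
        simpa [hx] using (hX x.1).symm)
    obtain ⟨r, hr⟩ := h X f hf a
    obtain ⟨k, hk⟩ := LinearMap.exists_factor_of_surjective f hf
      (LinearMap.snd R M J ∘ₗ X.subtype - i ∘ₗ r) (fun x hx => by
        have h1 := ha ⟨x, hx⟩
        simp only [LinearMap.comp_apply, Submodule.subtype_apply] at h1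
        simp [hr ⟨x, hx⟩, h1])
    refine ⟨k, fun m => ?_⟩
    obtain ⟨x, rfl⟩ := hf m
    have := hip.apply_apply_eq_zero (r x)
    have hgx : g (f x) = p (x : M × J).2 := hX x
    rw [hk, hgx]
    simp [this]
  · intro h X _ _ f hf g
    obtain ⟨k, hk⟩ := hJ.out _ (Submodule.subtype_injective _) (i ∘ₗ g)
    have hk' : ∀ x (hx : f x = 0), k x = i (g ⟨x, hx⟩) := fun x hx => hk ⟨x, hx⟩
    obtain ⟨l, hl⟩ := LinearMap.exists_factor_of_surjective f hf (p ∘ₗ k) (fun x hx => by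
      simp [hk' x hx, hip.apply_apply_eq_zero])
    obtain ⟨m, hm⟩ := h l
    obtain ⟨n, hn⟩ := LinearMap.exists_factor_of_injective i hi (k - m ∘ₗ f) (fun x => by
      apply (hip _).1
      simp [hm, hl])
    refine ⟨n, fun x => hi ?_⟩
    have hx : f x = 0 := x.2
    rw [hn, LinearMap.sub_apply, LinearMap.comp_apply, hx, map_zero, sub_zero, hk' _ hx]

/-- Dimension shifting. -/
lemma extOneVanishes_shift (hP : Module.Projective R P) (f : P →ₗ[R] M)
    (hf : Function.Surjective f) (hJ : Module.Injective R J) (i : N →ₗ[R] J)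
    (hi : Function.Injective i) (p : J →ₗ[R] C) (hp : Function.Surjective p)
    (hip : Function.Exact i p) :
    ExtOneVanishes R (LinearMap.ker f) N ↔ ExtOneVanishes R M C := by
  rw [extOneVanishes_iff_lift hJ i hi p hp hip, extOneVanishes_iff_extend hP f hf]
  refine forall_congr' fun g => ⟨?_, ?_⟩
  · rintro ⟨h, hh⟩
    obtain ⟨k, hk⟩ := hJ.out _ (Submodule.subtype_injective _) h
    exact ⟨p ∘ₗ k, fun x => by rw [← hh, ← hk]; rfl⟩
  · rintro ⟨h, hh⟩
    obtain ⟨k, hk⟩ := Module.projective_lifting_property p h hp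
    exact ⟨k ∘ₗ (LinearMap.ker f).subtype, fun x => by
      rw [← hh]; exact LinearMap.congr_fun hk x⟩

/-- A module is projective as soon as one projective presentation of it splits. -/
lemma Module.Projective.of_extOneVanishes_ker (hP : Module.Projective R P) (f : P →ₗ[R] M)
    (hf : Function.Surjective f) (h : ExtOneVanishes R M (LinearMap.ker f)) :
    Module.Projective R M := by
  obtain ⟨r, hr⟩ := h P f hf LinearMap.id
  obtain ⟨s, hs⟩ := LinearMap.exists_factor_of_surjective f hf
    (LinearMap.id - (LinearMap.ker f).subtype ∘ₗ r) (fun x hx => by simp [hr ⟨x, hx⟩])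
  refine Module.Projective.of_split s f (LinearMap.ext fun m => ?_)
  obtain ⟨x, rfl⟩ := hf m
  simp [hs]

/-- A module all of whose extensions split is projective. -/
lemma Module.Projective.of_extOneVanishes
    (h : ∀ (N : Type u) [AddCommGroup N] [Module R N], ExtOneVanishes R M N) :
    Module.Projective R M :=
  .of_extOneVanishes_ker inferInstance (Finsupp.linearCombination R id)
    (Finsupp.linearCombination_id_surjective R M) (h _)

end ExtVanishing

section Syzygies

open CategoryTheory

variable (R : Type u) [Ring R]

/-- The canonical free cover of a module. -/
noncomputable abbrev freeCover (M : Type u) [AddCommGroup M] [Module R M] : (M →₀ R) →ₗ[R] M :=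
  Finsupp.linearCombination R id

/-- The first syzygy of a module in its canonical free resolution. -/
noncomputable def syzygy (M : ModuleCat.{u} R) : ModuleCat.{u} R :=
  ModuleCat.of R (LinearMap.ker (freeCover R M))

/-- The first cosyzygy of a module with respect to a chosen injective hull. -/
noncomputable def cosyzygy (N : ModuleCat.{u} R) : ModuleCat.{u} R :=
  ModuleCat.of R (↑(Injective.under N) ⧸ LinearMap.range (Injective.ι N).hom)

lemma exists_injective_copresentation (N : ModuleCat.{u} R) :
    ∃ (J : ModuleCat.{u} R) (i : N →ₗ[R] J) (p : J →ₗ[R] cosyzygy R N),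
      Module.Injective R J ∧ Function.Injective i ∧ Function.Surjective p ∧
        Function.Exact i p := by
  refine ⟨Injective.under N, (Injective.ι N).hom,
    (LinearMap.range (Injective.ι N).hom).mkQ, ?_, ?_, Submodule.mkQ_surjective _, ?_⟩
  · exact (Module.injective_iff_injective_object R (Injective.under N : ModuleCat.{u} R)).2
      (Injective.injective_under N)
  · exact (ModuleCat.mono_iff_injective _).1 inferInstance
  · exact LinearMap.exact_map_mkQ_range _

variable {R}

lemma extOneVanishes_ker_iff {P M : Type u} [AddCommGroup P] [Module R P] [AddCommGroup M]
    [Module R M] (hP : Module.Projective R P) (f : P →ₗ[R] M) (hf : Function.Surjective f)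
    (N : ModuleCat.{u} R) :
    ExtOneVanishes R (LinearMap.ker f) N ↔ ExtOneVanishes R M (cosyzygy R N) := by
  obtain ⟨J, i, p, hJ, hi, hp, hip⟩ := exists_injective_copresentation R N
  exact extOneVanishes_shift hP f hf hJ i hi p hp hip

lemma extOneVanishes_syzygy_iff (M N : ModuleCat.{u} R) :
    ExtOneVanishes R (syzygy R M) N ↔ ExtOneVanishes R M (cosyzygy R N) :=
  extOneVanishes_ker_iff inferInstance (freeCover R M)
    (Finsupp.linearCombination_id_surjective R M) N

lemma extOneVanishes_syzygy_iterate_iff (k : ℕ) (M N : ModuleCat.{u} R) :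
    ExtOneVanishes R ((syzygy R)^[k] M) N ↔ ExtOneVanishes R M ((cosyzygy R)^[k] N) := by
  induction k generalizing M with
  | zero => rfl
  | succ k ih =>
    rw [Function.iterate_succ_apply, ih, extOneVanishes_syzygy_iff, Function.iterate_succ_apply']

lemma projDimLE_of_projective_syzygy (n : ℕ) (M : ModuleCat.{u} R)
    (h : Module.Projective R ((syzygy R)^[n] M)) : ProjDimLE R n M := by
  induction n generalizing M with
  | zero => exact h
  | succ n ih =>
    exact Or.inr ⟨ModuleCat.of R (M →₀ R), freeCover R M,
      inferInstanceAs (Module.Projective R (M →₀ R)),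
      Finsupp.linearCombination_id_surjective R M, ih (syzygy R M) h⟩

lemma InjDimLE.extOneVanishes (n : ℕ) (N : Type u) [AddCommGroup N] [Module R N]
    (h : InjDimLE R n N) (M : ModuleCat.{u} R) : ExtOneVanishes R ((syzygy R)^[n] M) N := by
  induction n generalizing N M with
  | zero => exact .of_injective h
  | succ n ih =>
    rcases h with h | ⟨J, f, hJ, hf, h⟩
    · exact .of_injective h
    · rw [Function.iterate_succ_apply']
      exact (extOneVanishes_shift inferInstance (freeCover R ((syzygy R)^[n] M))
        (Finsupp.linearCombination_id_surjective R _) hJ f hf _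
        (Submodule.mkQ_surjective _) (LinearMap.exact_map_mkQ_range _)).2 (ih _ h M)

end Syzygies

section Finitistic

variable {R : Type u} [Ring R]

/-- If high syzygies have no extensions by free modules, then a module of finite projective
dimension has projective dimension at most `n`. -/
lemma extOneVanishes_cosyzygy_of_finite {n : ℕ}
    (H : ∀ (M : ModuleCat.{u} R) (X : Type u), ExtOneVanishes R ((syzygy R)^[n] M) (X →₀ R))
    (m : ℕ) (K : ModuleCat.{u} R)
    (h : ∀ N : ModuleCat.{u} R, ExtOneVanishes R K ((cosyzygy R)^[m] N)) (N : ModuleCat.{u} R) :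
    ExtOneVanishes R K ((cosyzygy R)^[n] N) := by
  rcases le_total m n with hmn | hmn
  · have := h ((cosyzygy R)^[n - m] N)
    rwa [← Function.iterate_add_apply, Nat.add_sub_cancel' hmn] at this
  · induction m, hmn using Nat.le_induction with
    | base => exact h N
    | succ m hm ih =>
      refine ih fun N => ?_
      have hproj : Module.Projective R ((syzygy R)^[m + 1] K) :=
        .of_extOneVanishes fun N _ _ =>
          (extOneVanishes_syzygy_iterate_iff (m + 1) K (ModuleCat.of R N)).2 (h _)
      rw [Function.iterate_succ_apply'] at hproj
      obtain ⟨s, hs⟩ := hproj.out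
      have hE : ExtOneVanishes R ((syzygy R)^[m] K) (syzygy R ((syzygy R)^[m] K)) := by
        refine ExtOneVanishes.of_retract (N := (syzygy R ((syzygy R)^[m] K)) →₀ R) ?_ s _ hs
        have := H ((syzygy R)^[m - n] K) (syzygy R ((syzygy R)^[m] K))
        rwa [← Function.iterate_add_apply, Nat.add_sub_cancel' hm] at this
      rw [← extOneVanishes_syzygy_iterate_iff]
      exact .of_projective (.of_extOneVanishes_ker inferInstance
        (freeCover R ((syzygy R)^[m] K)) (Finsupp.linearCombination_id_surjective R _) hE)

end Finitistic

section LocallySplit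

variable {R : Type u} [Ring R] {P : Type u} [AddCommGroup P] [Module R P]

/-- A countably generated submodule whose elements are fixed by endomorphisms with values in the
submodule is projective. -/
lemma projective_span_range_of_locallySplit (hP : Module.Projective R P) (w : ℕ → P)
    (hw : ∀ l ∈ Submodule.span R (Set.range w), ∃ θ : P →ₗ[R] P,
      (∀ x, θ x ∈ Submodule.span R (Set.range w)) ∧ θ l = l) :
    Module.Projective R (Submodule.span R (Set.range w)) := by
  let L : Submodule R P := Submodule.span R (Set.range w)
  have hwL : ∀ k, w k ∈ L := fun k => Submodule.subset_span ⟨k, rfl⟩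
  have key : ∀ l : P, ∃ θ : P →ₗ[R] P, (∀ x, θ x ∈ L) ∧ (l ∈ L → θ l = l) := fun l => by
    by_cases hl : l ∈ L
    · obtain ⟨θ, h1, h2⟩ := hw l hl
      exact ⟨θ, h1, fun _ => h2⟩
    · exact ⟨0, fun _ => by simp, fun h => absurd h hl⟩
  choose θ hθL hθ using key
  let r : ℕ → P →ₗ[R] P := fun k => Nat.rec LinearMap.id (fun k r => r - θ (r (w k)) ∘ₗ r) k
  have hr0 : ∀ x, r 0 x = x := fun _ => rfl
  have hrs : ∀ k x, r (k + 1) x = r k x - θ (r k (w k)) (r k x) := fun _ _ => rfl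
  have hrL : ∀ k x, x ∈ L → r k x ∈ L := fun k => by
    induction k with
    | zero => exact fun x hx => hx
    | succ k ih => exact fun x hx => by rw [hrs]; exact L.sub_mem (ih x hx) (hθL _ _)
  have hr_zero : ∀ k x, r k x = 0 → ∀ j, k ≤ j → r j x = 0 := fun k x hx j hj => by
    induction j, hj using Nat.le_induction with
    | base => exact hx
    | succ j _ ih => simp [hrs, ih]
  have hrw : ∀ k, r (k + 1) (w k) = 0 := fun k => by
    rw [hrs, hθ _ (hrL k _ (hwL k)), sub_self]
  have hev : ∀ l ∈ L, ∃ k, r k l = 0 := fun l hl => by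
    induction hl using Submodule.span_induction with
    | mem x hx => obtain ⟨k, rfl⟩ := hx; exact ⟨k + 1, hrw k⟩
    | zero => exact ⟨0, by simp⟩
    | add x y _ _ hx hy =>
      obtain ⟨a, ha⟩ := hx
      obtain ⟨b, hb⟩ := hy
      exact ⟨max a b, by
        rw [map_add, hr_zero a x ha _ (le_max_left _ _), hr_zero b y hb _ (le_max_right _ _),
          add_zero]⟩
    | smul c x _ hx => obtain ⟨a, ha⟩ := hx; exact ⟨a, by simp [ha]⟩
  let ev : (ℕ →₀ P) →ₗ[R] (ℕ → P) := Finsupp.lcoeFun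
  obtain ⟨s, hs⟩ := LinearMap.exists_factor_of_injective ev DFunLike.coe_injective
    (LinearMap.pi fun k => r k ∘ₗ L.subtype) (fun l => by
      obtain ⟨k, hk⟩ := hev l l.2
      refine ⟨Finsupp.onFinset (Finset.range k) (fun j => r j l) fun j hj => ?_, ?_⟩
      · by_contra hjk
        exact hj (hr_zero k l hk j (by simpa using hjk))
      · ext j; rfl)
  have hs' : ∀ l : L, ∀ k, s l k = r k l := fun l k => congrFun (hs l) k
  let Θ : (ℕ →₀ P) →ₗ[R] L := Finsupp.lsum ℕ fun k =>
    (θ (r k (w k))).codRestrict L fun x => hθL _ x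
  have : Module.Projective R (ℕ →₀ P) := by
    classical
    exact Module.Projective.of_equiv (finsuppLequivDFinsupp (ι := ℕ) (M := P) R).symm
  refine Module.Projective.of_split s Θ (LinearMap.ext fun l => Subtype.ext ?_)
  obtain ⟨k, hk⟩ := hev l l.2
  have hsupp : (s l).support ⊆ Finset.range k := fun j hj => by
    by_contra hjk
    exact (Finsupp.mem_support_iff.1 hj) (by
      rw [hs']; exact hr_zero k l hk j (by simpa using hjk))
  have : Θ (s l) = ∑ j ∈ Finset.range k,
      (⟨θ (r j (w j)) (s l j), hθL _ _⟩ : L) := by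
    simp only [Θ, Finsupp.lsum_apply]
    rw [Finsupp.sum_of_support_subset _ hsupp]
    · rfl
    · intro i _; simp
  rw [LinearMap.comp_apply, this]
  simp only [LinearMap.id_apply, AddSubmonoidClass.coe_finsetSum, hs']
  have h2 : ∀ j, θ (r j (w j)) (r j (l : P)) = r j l - r (j + 1) l := fun j => by
    rw [hrs]; abel
  simp only [h2]
  rw [Finset.sum_range_sub', hk, hr0, sub_zero]

end LocallySplit

section FinClosure

open Cardinal

variable {α : Type u}

/-- The closure of a set under an operation sending finite sets to finite sets. -/
inductive FinClosure (c : Finset α → Finset α) (I : Set α) : α → Prop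
  | base {x : α} (hx : x ∈ I) : FinClosure c I x
  | step {x : α} (T : Finset α) (hT : ∀ t ∈ T, FinClosure c I t) (hx : x ∈ c T) :
      FinClosure c I x

lemma FinClosure.mono {c : Finset α → Finset α} {I I' : Set α} (h : I ⊆ I') {x : α}
    (hx : FinClosure c I x) : FinClosure c I' x := by
  induction hx with
  | base hx => exact .base (h hx)
  | step T _ hx ih => exact .step T ih hx

lemma FinClosure.mem_of_subset {c : Finset α → Finset α} {I W : Set α} (h : I ⊆ W)
    (hc : ∀ T : Finset α, (T : Set α) ⊆ W → (c T : Set α) ⊆ W) {x : α}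
    (hx : FinClosure c I x) : x ∈ W := by
  induction hx with
  | base hx => exact h hx
  | step T _ hx ih => exact hc T ih hx

lemma FinClosure.exists_finset {c : Finset α → Finset α} {O : Type*} {w : O → α} {I : Set O}
    {x : α} (hx : FinClosure c (w '' I) x) :
    ∃ T : Finset O, (T : Set O) ⊆ I ∧ FinClosure c (w '' (T : Set O)) x := by
  classical
  induction hx with
  | base hx =>
    obtain ⟨i, hi, rfl⟩ := hx
    exact ⟨{i}, by simpa using hi, .base ⟨i, by simp, rfl⟩⟩
  | step T _ hx ih =>
    choose! f hfI hf using ih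
    refine ⟨T.biUnion f, by simpa using hfI, .step T (fun t ht => (hf t ht).mono ?_) hx⟩
    exact Set.image_mono (by exact_mod_cast Finset.subset_biUnion_of_mem f ht)

lemma FinClosure.mk_le (c : Finset α → Finset α) (I : Set α) :
    #{x | FinClosure c I x} ≤ max #I ℵ₀ := by
  classical
  let κ : Cardinal.{u} := max #I ℵ₀
  have hκ : ℵ₀ ≤ κ := le_max_right _ _
  let st : Set α → Set α := fun A =>
    A ∪ ⋃ T : Finset A, (c (T.map (Function.Embedding.subtype (· ∈ A))) : Set α)
  let A : ℕ → Set α := fun k => st^[k] I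
  have hAs : ∀ k, A (k + 1) = st (A k) := fun k => Function.iterate_succ_apply' st k I
  have hcard : ∀ k, #(A k) ≤ κ := fun k => by
    induction k with
    | zero => exact le_max_left _ _
    | succ k ih =>
      have hfin : #(Finset (A k)) ≤ κ := by
        rcases finite_or_infinite (A k) with h | h
        · exact (Cardinal.lt_aleph0_of_finite _).le.trans hκ
        · rw [Cardinal.mk_finset_of_infinite]; exact ih
      rw [hAs]
      refine (Cardinal.mk_union_le _ _).trans (Cardinal.add_le_of_le hκ ih ?_)
      refine (Cardinal.mk_iUnion_le _).trans (Cardinal.mul_le_of_le hκ hfin ?_)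
      exact ciSup_le' fun T => (Cardinal.lt_aleph0_of_finite _).le.trans hκ
  have hmono : Monotone A := monotone_nat_of_le_succ fun k => by
    rw [hAs]; exact Set.subset_union_left
  have hsub : {x | FinClosure c I x} ⊆ ⋃ k : ULift.{u} ℕ, A k.down := by
    intro x hx
    rw [Set.mem_iUnion]
    induction hx with
    | base hx => exact ⟨⟨0⟩, hx⟩
    | step T _ hx ih =>
      choose! f hf using ih
      let k := T.sup fun t => (f t).down
      have hk : ∀ t ∈ T, t ∈ A k := fun t ht =>
        hmono (Finset.le_sup (f := fun t => (f t).down) ht) (hf t ht)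
      refine ⟨⟨k + 1⟩, ?_⟩
      change _ ∈ A (k + 1)
      rw [hAs]
      refine Or.inr (Set.mem_iUnion.2 ⟨T.subtype (· ∈ A k), ?_⟩)
      rw [Finset.subtype_map_of_mem hk]
      exact hx
  refine (Cardinal.mk_le_mk_of_subset hsub).trans ((Cardinal.mk_iUnion_le _).trans
    (Cardinal.mul_le_of_le hκ (by simp) ?_))
  exact ciSup_le' fun k => hcard _

end FinClosure

section Chain

variable {R : Type u} [Ring R] {P : Type u} [AddCommGroup P] [Module R P]

lemma extOneVanishes_of_chain {O : Type*} [LinearOrder O] [WellFoundedLT O]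
    (F : Set O → Submodule R P) (hmono : Monotone F)
    (hF : ∀ I x, x ∈ F I → ∃ T : Finset O, (T : Set O) ⊆ I ∧ x ∈ F T) (D : ModuleCat.{u} R)
    (h0 : ExtOneVanishes R (F ∅) (cosyzygy R D))
    (hIio : ∀ b, ExtOneVanishes R (F (Set.Iio b)) D)
    (hIic : ∀ b, ExtOneVanishes R (F (Set.Iic b)) (cosyzygy R D)) :
    ExtOneVanishes R (F Set.univ) (cosyzygy R D) := by
  obtain ⟨J, i, p, hJ, hi, hp, hip⟩ := exists_injective_copresentation R D
  obtain ⟨J', i', p', hJ', hi', hp', hip'⟩ := exists_injective_copresentation R (cosyzygy R D)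
  have lift_iff (M : Type u) [AddCommGroup M] [Module R M] :
      ExtOneVanishes R M (cosyzygy R D) ↔ _ := extOneVanishes_iff_lift hJ' i' hi' p' hp' hip'
  rw [lift_iff]
  intro h
  have hle : ∀ I, F I ≤ F Set.univ := fun I => hmono (Set.subset_univ I)
  let S : Set (P →ₗ.[R] J') := {g | ∃ I : Set O, IsLowerSet I ∧ g.domain = F I ∧
    ∀ (x : g.domain) (hx : (x : P) ∈ F Set.univ), p' (g x) = h ⟨x, hx⟩}
  have mkS : ∀ I, IsLowerSet I → ∀ g : F I →ₗ[R] J',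
      (∀ x, p' (g x) = h (Submodule.inclusion (hle I) x)) → (⟨F I, g⟩ : P →ₗ.[R] J') ∈ S :=
    fun I hI g hg => ⟨I, hI, rfl, fun x hx => hg x⟩
  obtain ⟨g0, hg0⟩ := (lift_iff _).1 h0 (h ∘ₗ Submodule.inclusion (hle ∅))
  obtain ⟨g, -, hg⟩ := zorn_le_nonempty₀ S (fun C hCS hC y hy => by
    have hdir := hC.directedOn
    refine ⟨LinearPMap.sSup C hdir, ?_, fun z hz => LinearPMap.le_sSup hdir hz⟩
    replace hCS : ∀ z, ∃ I : Set O, z ∈ C → IsLowerSet I ∧ z.domain = F I ∧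
        ∀ (x : z.domain) (hx : (x : P) ∈ F Set.univ), p' (z x) = h ⟨x, hx⟩ := fun z => by
      by_cases hz : z ∈ C
      · obtain ⟨I, hI⟩ := hCS hz
        exact ⟨I, fun _ => hI⟩
      · exact ⟨∅, fun hz' => absurd hz' hz⟩
    choose I hI using hCS
    have hIl := fun z hz => (hI z hz).1
    have hId := fun z hz => (hI z hz).2.1
    have hIh := fun z hz => (hI z hz).2.2
    refine ⟨⋃ z ∈ C, I z, isLowerSet_iUnion fun z => isLowerSet_iUnion fun hz => hIl z hz, ?_, ?_⟩
    · ext x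
      rw [LinearPMap.mem_domain_sSup_iff ⟨y, hy⟩ hdir]
      constructor
      · rintro ⟨z, hz, hx⟩
        rw [hId z hz] at hx
        exact hmono (Set.subset_biUnion_of_mem hz) hx
      · intro hx
        obtain ⟨T, hTI, hxT⟩ := hF _ _ hx
        have hT : ∃ z ∈ C, (T : Set O) ⊆ I z := by
          clear hxT
          classical
          induction T using Finset.induction_on with
          | empty => exact ⟨y, hy, by simp⟩
          | insert t T _ ih =>
            rw [Finset.coe_insert, Set.insert_subset_iff] at hTI
            obtain ⟨z, hz, hzT⟩ := ih hTI.2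
            obtain ⟨z', hz', htz'⟩ := Set.mem_iUnion₂.1 hTI.1
            rcases (hIl z hz).total (hIl z' hz') with hzz | hzz
            · exact ⟨z', hz', by
                rw [Finset.coe_insert, Set.insert_subset_iff]; exact ⟨htz', hzT.trans hzz⟩⟩
            · exact ⟨z, hz, by
                rw [Finset.coe_insert, Set.insert_subset_iff]; exact ⟨hzz htz', hzT⟩⟩
        obtain ⟨z, hz, hzT⟩ := hT
        exact ⟨z, hz, by rw [hId z hz]; exact hmono hzT hxT⟩
    · rintro ⟨x, hx⟩ hx'
      obtain ⟨z, hz, hxz⟩ := (LinearPMap.mem_domain_sSup_iff ⟨y, hy⟩ hdir).1 hx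
      have : z ⟨x, hxz⟩ = LinearPMap.sSup C hdir ⟨x, hx⟩ :=
        (LinearPMap.le_sSup hdir hz).2 rfl
      rw [← this]
      exact hIh z hz ⟨x, hxz⟩ hx') _ (mkS ∅ isLowerSet_empty g0 hg0)
  obtain ⟨⟨I₀, hI₀, hgI₀, hgh⟩, hmax⟩ := hg
  let I : Set O := {a | F (Set.Iic a) ≤ g.domain}
  have hI : IsLowerSet I := fun a a' haa ha => (hmono (Set.Iic_subset_Iic.2 haa)).trans ha
  have hgI : g.domain = F I := by
    refine le_antisymm ?_ fun x hx => ?_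
    · rw [hgI₀]
      exact hmono fun a ha => (hmono fun a' ha' => hI₀ ha' ha).trans hgI₀.ge
    · obtain ⟨T, hTI, hxT⟩ := hF I x hx
      rcases T.eq_empty_or_nonempty with rfl | hT
      · rw [hgI₀]
        exact hmono (by simp) hxT
      · exact hTI (T.max'_mem hT) (hmono (fun a ha => T.le_max' a ha) hxT)
  have hIg : ∀ b, F (Set.Iic b) ≤ g.domain → b ∈ I := fun b hb => hb
  clear_value I
  obtain ⟨L, g⟩ := g
  dsimp only at hgI
  subst hgI
  by_cases hIu : I = Set.univ
  · subst hIu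
    exact ⟨g, fun x => hgh x x.2⟩
  exfalso
  obtain ⟨b, hbI, hbmin⟩ := WellFounded.has_min (r := ((· < ·) : O → O → Prop)) wellFounded_lt
    Iᶜ (Set.nonempty_compl.2 hIu)
  obtain rfl : I = Set.Iio b := by
    ext a
    refine ⟨fun ha => lt_of_not_ge fun hba => hbI (hI hba ha), fun ha => ?_⟩
    by_contra haI
    exact hbmin a haI ha
  have hle' : F (Set.Iio b) ≤ F (Set.Iic b) := hmono Set.Iio_subset_Iic_self
  obtain ⟨g', hg'⟩ := (lift_iff _).1 (hIic b) (h ∘ₗ Submodule.inclusion (hle _))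
  obtain ⟨d, hd⟩ := LinearMap.exists_factor_of_injective i' hi'
    (g - g' ∘ₗ Submodule.inclusion hle') (fun x => by
      apply (hip' _).1
      have h1 : p' (g x) = h ⟨x, hle _ x.2⟩ := hgh x (hle _ x.2)
      have h2 := hg' (Submodule.inclusion hle' x)
      rw [LinearMap.sub_apply, map_sub, h1, LinearMap.comp_apply, h2]
      exact sub_self _)
  obtain ⟨e, he⟩ := (extOneVanishes_iff_lift hJ i hi p hp hip).1 (hIio b) d
  obtain ⟨e', he'⟩ := hJ.out _ (Submodule.inclusion_injective hle') e
  have hmem : (⟨F (Set.Iic b), g' + i' ∘ₗ p ∘ₗ e'⟩ : P →ₗ.[R] J') ∈ S :=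
    mkS _ (isLowerSet_Iic b) _ fun x => by
      rw [LinearMap.add_apply, map_add, hg', LinearMap.comp_apply i', hip'.apply_apply_eq_zero,
        add_zero]
      rfl
  have hge := hmax hmem ⟨hle', fun x y hxy => by
    obtain rfl : Submodule.inclusion hle' x = y := Subtype.ext hxy
    have h1 := hd x
    rw [← he, ← he', LinearMap.sub_apply, LinearMap.comp_apply, eq_sub_iff_add_eq] at h1
    change g x = (g' + i' ∘ₗ p ∘ₗ e') _
    rw [← h1, add_comm]
    rfl⟩
  exact hbI (hIg b hge.1)

end Chain

section FinitelySplit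

open Cardinal

variable {R : Type u} [Ring R] {P : Type u} [AddCommGroup P] [Module R P]

/-- Every finite subset of `W` is fixed by an endomorphism of `P` with values in the span of a
finite subset of `W`. -/
def FinitelySplit (R : Type u) [Ring R] {P : Type u} [AddCommGroup P] [Module R P] (W : Set P) :
    Prop :=
  ∀ T : Finset P, (T : Set P) ⊆ W → ∃ V : Finset P, (V : Set P) ⊆ W ∧ ∃ θ : P →ₗ[R] P,
    (∀ x, θ x ∈ Submodule.span R (V : Set P)) ∧ ∀ t ∈ T, θ t = t

lemma FinitelySplit.projective_of_countable (hP : Module.Projective R P) {W : Set P}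
    (hW : FinitelySplit R W) (hc : W.Countable) :
    Module.Projective R (Submodule.span R W) := by
  obtain ⟨w, hw⟩ := (hc.insert 0).exists_eq_range (Set.insert_nonempty _ _)
  have hspan : Submodule.span R (Set.range w) = Submodule.span R W := by
    rw [← hw, Submodule.span_insert_zero]
  rw [← hspan]
  refine projective_span_range_of_locallySplit hP w fun l hl => ?_
  rw [hspan] at hl ⊢
  obtain ⟨T, hTW, hT⟩ := Submodule.subset_span_finite_of_subset_span
    (t := {l}) (by simpa using hl)
  obtain ⟨V, hVW, θ, hθ, hθT⟩ := hW T hTW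
  refine ⟨θ, fun x => Submodule.span_mono hVW (hθ x), ?_⟩
  have : Set.EqOn θ LinearMap.id (Submodule.span R (T : Set P)) :=
    LinearMap.eqOn_span fun t ht => hθT t ht
  exact this (hT (by simp))

lemma extOneVanishes_span_iff (hP : Module.Projective R P) (L : Submodule R P)
    (N : ModuleCat.{u} R) :
    ExtOneVanishes R L N ↔ ExtOneVanishes R (P ⧸ L) (cosyzygy R N) := by
  rw [← extOneVanishes_ker_iff hP L.mkQ L.mkQ_surjective N]
  let e : L ≃ₗ[R] LinearMap.ker L.mkQ := LinearEquiv.ofEq _ _ L.ker_mkQ.symm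
  exact ⟨fun h => h.of_linearEquiv e, fun h => h.of_linearEquiv e.symm⟩

/-- If high syzygies have no extensions by free modules, then the quotient of a projective module
by a finitely split submodule has projective dimension at most `n`. -/
theorem FinitelySplit.extOneVanishes {n : ℕ}
    (H : ∀ (M : ModuleCat.{u} R) (X : Type u), ExtOneVanishes R ((syzygy R)^[n] M) (X →₀ R))
    (hP : Module.Projective R P) {W : Set P} (hW : FinitelySplit R W) (N : ModuleCat.{u} R) :
    ExtOneVanishes R (P ⧸ Submodule.span R W) ((cosyzygy R)^[n] N) := by
  obtain ⟨κ, hκ⟩ : ∃ κ, #W = κ := ⟨_, rfl⟩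
  induction κ using WellFoundedLT.induction generalizing W N with
  | ind κ ih =>
  by_cases hc : W.Countable
  · refine extOneVanishes_cosyzygy_of_finite H 1 (ModuleCat.of R (P ⧸ Submodule.span R W))
      (fun N => ?_) N
    exact (extOneVanishes_span_iff hP _ N).1 (.of_projective (hW.projective_of_countable hP hc))
  have hunc : ℵ₀ < κ := by
    rw [← hκ]
    exact lt_of_not_ge fun h => hc (Cardinal.le_aleph0_iff_set_countable.1 h)
  have hW' : ∀ T : Finset P, ∃ V : Finset P, (T : Set P) ⊆ W → (V : Set P) ⊆ W ∧
      ∃ θ : P →ₗ[R] P, (∀ x, θ x ∈ Submodule.span R (V : Set P)) ∧ ∀ t ∈ T, θ t = t := fun T => by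
    by_cases hT : (T : Set P) ⊆ W
    · obtain ⟨V, hV⟩ := hW T hT
      exact ⟨V, fun _ => hV⟩
    · exact ⟨∅, fun h => absurd h hT⟩
  choose c hc' using hW'
  let O := (#W).ord.ToType
  obtain ⟨e⟩ : Nonempty (O ≃ W) := Cardinal.eq.1 (Cardinal.mk_ord_toType _)
  let w : O → P := fun o => e o
  have hw : ∀ I : Set O, w '' I ⊆ W := by
    rintro I _ ⟨o, -, rfl⟩
    exact (e o).2
  let cl : Set O → Set P := fun I => {x | FinClosure c (w '' I) x}
  have hclW : ∀ I, cl I ⊆ W := fun I x hx =>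
    FinClosure.mem_of_subset (hw I) (fun T hT => (hc' T hT).1) hx
  have hclS : ∀ I, FinitelySplit R (cl I) := fun I T hT =>
    ⟨c T, fun x hx => FinClosure.step T hT hx, (hc' T (hT.trans (hclW I))).2⟩
  have hclc : ∀ I : Set O, #I < κ → #(cl I) < κ := fun I hI =>
    (FinClosure.mk_le c _).trans_lt (max_lt (Cardinal.mk_image_le.trans_lt hI) hunc)
  have hcl_univ : cl Set.univ = W := (hclW _).antisymm fun x hx =>
    FinClosure.base ⟨e.symm ⟨x, hx⟩, trivial, by simp [w]⟩
  let F : Set O → Submodule R P := fun I => Submodule.span R (cl I)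
  have hclmono : ∀ {I I'}, I ⊆ I' → cl I ⊆ cl I' := fun h x hx => hx.mono (Set.image_mono h)
  have hFmono : Monotone F := fun I I' h => Submodule.span_mono (hclmono h)
  have hFfin : ∀ I x, x ∈ F I → ∃ T : Finset O, (T : Set O) ⊆ I ∧ x ∈ F T := fun I x hx => by
    classical
    induction hx using Submodule.span_induction with
    | mem x hx =>
      obtain ⟨T, hT, hx⟩ := FinClosure.exists_finset hx
      exact ⟨T, hT, Submodule.subset_span hx⟩
    | zero => exact ⟨∅, by simp, zero_mem _⟩
    | add x y _ _ hx hy =>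
      obtain ⟨T, hT, hx⟩ := hx
      obtain ⟨T', hT', hy⟩ := hy
      exact ⟨T ∪ T', by simp [hT, hT'], add_mem (hFmono (by simp) hx) (hFmono (by simp) hy)⟩
    | smul a x _ hx =>
      obtain ⟨T, hT, hx⟩ := hx
      exact ⟨T, hT, Submodule.smul_mem _ _ hx⟩
  have hE : ∀ (I : Set O) (N : ModuleCat.{u} R), #I < κ →
      ExtOneVanishes R (F I) ((cosyzygy R)^[n] N) := fun I N hI => by
    rw [extOneVanishes_span_iff hP, ← Function.iterate_succ_apply' (cosyzygy R),
      Function.iterate_succ_apply]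
    exact ih _ (hclc I hI) (hclS I) _ rfl
  have hIio : ∀ b : O, #(Set.Iio b) < κ := fun b => by
    rw [← hκ]
    have := Cardinal.mk_Iio_lt b (by simp [O])
    simpa [O] using this
  have hIic : ∀ b : O, #(Set.Iic b) < κ := fun b => by
    rw [← Set.Iio_insert]
    exact (Cardinal.mk_insert_le).trans_lt
      (Cardinal.add_lt_of_lt hunc.le (hIio b) (Cardinal.one_lt_aleph0.trans hunc))
  refine extOneVanishes_cosyzygy_of_finite H (n + 2) (ModuleCat.of R (P ⧸ Submodule.span R W))
    (fun N => ?_) N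
  have hmain : ExtOneVanishes R (F Set.univ) ((cosyzygy R)^[n + 1] N) := by
    rw [Function.iterate_succ_apply']
    refine extOneVanishes_of_chain F hFmono hFfin _ ?_ (fun b => hE _ _ (hIio b)) fun b => ?_
    · rw [← Function.iterate_succ_apply' (cosyzygy R), Function.iterate_succ_apply]
      refine hE _ _ ?_
      simpa using Cardinal.aleph0_pos.trans hunc
    · rw [← Function.iterate_succ_apply' (cosyzygy R), Function.iterate_succ_apply]
      exact hE _ _ (hIic b)
  have : F Set.univ = Submodule.span R W := by simp only [F, hcl_univ]
  rw [this, extOneVanishes_span_iff hP, ← Function.iterate_succ_apply' (cosyzygy R)] at hmain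
  exact hmain

end FinitelySplit

section Characters

/-- A character killing the kernel of a homomorphism factors through the homomorphism. -/
lemma exists_character_factor {X Y : Type*} [AddCommGroup X] [AddCommGroup Y] (α : X →+ Y)
    (γ : X →+ AddCircle (1 : ℚ)) (h : ∀ x, α x = 0 → γ x = 0) :
    ∃ δ : Y →+ AddCircle (1 : ℚ), ∀ x, δ (α x) = γ x := by
  obtain ⟨k, hk⟩ := LinearMap.exists_factor_of_surjective (R := ℤ)
    α.toIntLinearMap.rangeRestrict α.toIntLinearMap.surjective_rangeRestrict γ.toIntLinearMap
    (fun x hx => h x (congrArg Subtype.val hx))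
  obtain ⟨δ, hδ⟩ := CharacterModule.dual_surjective_of_injective
    (LinearMap.range α.toIntLinearMap).subtype (Submodule.subtype_injective _) k.toAddMonoidHom
  refine ⟨δ, fun x => ?_⟩
  exact (DFunLike.congr_fun hδ (α.toIntLinearMap.rangeRestrict x)).trans (hk x)

variable {A B : Type u} [Ring A] [Ring B]

/-- The character group of a left `B`-module, viewed as a left module over a ring isomorphic to
the opposite of `B`. -/
def OpDual (_ : A ≃+* Bᵐᵒᵖ) (X : Type u) [AddCommGroup X] [Module B X] : Type u :=
  X →+ AddCircle (1 : ℚ)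

namespace OpDual

variable (τ : A ≃+* Bᵐᵒᵖ) {X Y Z : Type u} [AddCommGroup X] [Module B X] [AddCommGroup Y]
  [Module B Y] [AddCommGroup Z] [Module B Z]

instance : AddCommGroup (OpDual τ X) := inferInstanceAs (AddCommGroup (X →+ AddCircle (1 : ℚ)))

instance : FunLike (OpDual τ X) X (AddCircle (1 : ℚ)) :=
  inferInstanceAs (FunLike (X →+ AddCircle (1 : ℚ)) X (AddCircle (1 : ℚ)))

instance : AddMonoidHomClass (OpDual τ X) X (AddCircle (1 : ℚ)) :=
  inferInstanceAs (AddMonoidHomClass (X →+ AddCircle (1 : ℚ)) X (AddCircle (1 : ℚ)))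

variable {τ}

@[ext] lemma ext {χ ψ : OpDual τ X} (h : ∀ x, χ x = ψ x) : χ = ψ := DFunLike.ext _ _ h

@[simp] lemma add_apply (χ ψ : OpDual τ X) (x : X) : (χ + ψ) x = χ x + ψ x := rfl

@[simp] lemma sub_apply (χ ψ : OpDual τ X) (x : X) : (χ - ψ) x = χ x - ψ x := rfl

@[simp] lemma zero_apply (x : X) : (0 : OpDual τ X) x = 0 := rfl

instance : SMul A (OpDual τ X) :=
  ⟨fun a χ => AddMonoidHom.comp χ (DistribSMul.toAddMonoidHom X (τ a).unop)⟩

@[simp] lemma smul_apply (a : A) (χ : OpDual τ X) (x : X) : (a • χ) x = χ ((τ a).unop • x) := rfl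

instance : Module A (OpDual τ X) where
  one_smul χ := by ext x; simp
  mul_smul a b χ := by ext x; simp [mul_smul]
  smul_zero a := by ext x; simp
  smul_add a χ ψ := by ext x; simp
  add_smul a b χ := by ext x; simp [add_smul]
  zero_smul χ := by ext x; simp

variable (τ)

/-- Precomposition with a linear map. -/
def map (f : X →ₗ[B] Y) : OpDual τ Y →ₗ[A] OpDual τ X where
  toFun χ := AddMonoidHom.comp χ f.toAddMonoidHom
  map_add' _ _ := rfl
  map_smul' a χ := by
    ext x
    exact congrArg χ (f.map_smul _ x).symm

@[simp] lemma map_apply (f : X →ₗ[B] Y) (χ : OpDual τ Y) (x : X) : map τ f χ x = χ (f x) := rfl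

lemma map_injective (f : X →ₗ[B] Y) (hf : Function.Surjective f) :
    Function.Injective (map τ f) := fun χ ψ h => by
  ext y
  obtain ⟨x, rfl⟩ := hf y
  exact DFunLike.congr_fun h x

lemma map_surjective (f : X →ₗ[B] Y) (hf : Function.Injective f) :
    Function.Surjective (map τ f) := fun χ => by
  obtain ⟨δ, hδ⟩ := exists_character_factor f.toAddMonoidHom χ (fun x hx => by
    obtain rfl : x = 0 := hf (by simpa using hx)
    exact map_zero χ)
  exact ⟨δ, ext hδ⟩

lemma map_exact_ker (g : Y →ₗ[B] Z) :
    Function.Exact (map τ g) (map τ (LinearMap.ker g).subtype) := fun χ => by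
  constructor
  · intro hχ
    obtain ⟨δ, hδ⟩ := exists_character_factor g.toAddMonoidHom χ
      (fun y hy => DFunLike.congr_fun hχ ⟨y, hy⟩)
    exact ⟨δ, ext hδ⟩
  · rintro ⟨χ, rfl⟩
    ext x
    simp

variable {τ} in
lemma ext_single {S : Type u} {χ ψ : OpDual τ (S →₀ B)}
    (h : ∀ s b, χ (Finsupp.single s b) = ψ (Finsupp.single s b)) : χ = ψ :=
  Finsupp.addHom_ext (f := χ) (g := ψ) h

/-- The character of a free module with prescribed values on the multiples of the basis. -/
noncomputable def ofFamily {S : Type u} (χ : S → B →+ AddCircle (1 : ℚ)) : OpDual τ (S →₀ B) :=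
  Finsupp.liftAddHom χ

@[simp] lemma ofFamily_single {S : Type u} (χ : S → B →+ AddCircle (1 : ℚ)) (s : S) (b : B) :
    ofFamily τ χ (Finsupp.single s b) = χ s b :=
  Finsupp.liftAddHom_apply_single _ _ _

/-- A family of characters of an `A`-module `M` coinduces a linear map from `M` to the dual of a
free `B`-module. -/
noncomputable def lift {M : Type u} [AddCommGroup M] [Module A M] {S : Type u}
    (χ : S → M →+ AddCircle (1 : ℚ)) : M →ₗ[A] OpDual τ (S →₀ B) where
  toFun m := ofFamily τ fun s =>
    { toFun := fun b => χ s (τ.symm (MulOpposite.op b) • m)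
      map_zero' := by simp
      map_add' := by simp [add_smul] }
  map_add' m m' := ext_single fun s b => by simp
  map_smul' a m := ext_single fun s b => by
    simp [← mul_smul, -Finsupp.single_mul]

@[simp] lemma lift_single {M : Type u} [AddCommGroup M] [Module A M] {S : Type u}
    (χ : S → M →+ AddCircle (1 : ℚ)) (m : M) (s : S) (b : B) :
    lift τ χ m (Finsupp.single s b) = χ s (τ.symm (MulOpposite.op b) • m) :=
  ofFamily_single _ _ _ _

instance injective_finsupp (S : Type u) : Module.Injective A (OpDual τ (S →₀ B)) where
  out X Y _ _ _ _ f hf g := by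
    have (s : S) : ∃ χ : Y →+ AddCircle (1 : ℚ), ∀ x, χ (f x) = g x (Finsupp.single s 1) :=
      exists_character_factor f.toAddMonoidHom
        { toFun := fun x => g x (Finsupp.single s 1)
          map_zero' := by simp
          map_add' := by simp } (fun x hx => by
        obtain rfl : x = 0 := hf (by simpa using hx)
        simp)
    choose χ hχ using this
    refine ⟨lift τ χ, fun x => ext_single fun s b => ?_⟩
    rw [lift_single, ← f.map_smul, hχ, g.map_smul]
    simp

end OpDual

end Characters

section LocallySplitCover

variable {A B : Type u} [Ring A] [Ring B]

/-- Every relation in the canonical presentation of `K` is fixed by an endomorphism of the free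
module with values in the module of relations. -/
def LocallySplitCover (B : Type u) [Ring B] (K : Type u) [AddCommGroup K] [Module B K] : Prop :=
  ∀ l : K →₀ B, freeCover B K l = 0 →
    ∃ θ : (K →₀ B) →ₗ[B] (K →₀ B), (∀ z, freeCover B K (θ z) = 0) ∧ θ l = l

/-- A module has a locally split canonical presentation if finitely presented cyclic modules have
no extensions by its dual. -/
lemma LocallySplitCover.of_extOneVanishes (τ : A ≃+* Bᵐᵒᵖ) {K : Type u} [AddCommGroup K]
    [Module B K] (h : ∀ a : Submodule A A, a.FG → ExtOneVanishes A (A ⧸ a) (OpDual τ K)) :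
    LocallySplitCover B K := by
  intro l hl
  let L := LinearMap.ker (freeCover B K)
  let T : (l.support → L) →+ L :=
    { toFun := fun u => ∑ x : l.support, l x • u x
      map_zero' := by simp
      map_add' := by simp [Finset.sum_add_distrib] }
  have hTu : ∀ u : l.support → L, (T u : K →₀ B) = ∑ x : l.support, l x • (u x : K →₀ B) :=
    fun u => by simp [T]
  let H : AddSubgroup L := AddMonoidHom.range (G := l.support → L) T
  by_cases hT : (⟨l, hl⟩ : L) ∈ H
  · obtain ⟨u, hu⟩ := hT
    classical
    refine ⟨Finsupp.linearCombination B fun x => if hx : x ∈ l.support then (u ⟨x, hx⟩ : K →₀ B)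
      else 0, fun z => ?_, ?_⟩
    · change _ ∈ L
      refine L.sum_mem fun x _ => L.smul_mem _ ?_
      dsimp only
      split_ifs
      exacts [Subtype.prop _, L.zero_mem]
    · rw [Finsupp.linearCombination_apply, Finsupp.sum, ← Finset.sum_coe_sort]
      have := congrArg Subtype.val hu
      rw [hTu] at this
      refine Eq.trans ?_ this
      refine Finset.sum_congr rfl fun x _ => ?_
      rw [dif_pos x.2]
  · exfalso
    obtain ⟨c, hc⟩ := CharacterModule.exists_character_apply_ne_zero_of_ne_zero
      (a := (QuotientAddGroup.mk' H ⟨l, hl⟩)) (by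
        rwa [ne_eq, QuotientAddGroup.mk'_apply, QuotientAddGroup.eq_zero_iff])
    obtain ⟨χ, hχ⟩ := OpDual.map_surjective τ L.subtype L.subtype_injective
      (AddMonoidHom.comp c (QuotientAddGroup.mk' H) : OpDual τ L)
    have hχ' : ∀ v : L, χ v = c (QuotientAddGroup.mk' H v) := fun v =>
      DFunLike.congr_fun hχ v
    have hχT : ∀ (x : l.support) (v : L), χ (l x • (v : K →₀ B)) = 0 := fun x v => by
      classical
      have := hχ' (T (Pi.single x v))
      rw [QuotientAddGroup.mk'_apply, (QuotientAddGroup.eq_zero_iff _).2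
        (show _ ∈ AddMonoidHom.range (G := l.support → L) T from ⟨_, rfl⟩), map_zero, hTu,
        Finset.sum_eq_single x (fun y _ hy => by rw [Pi.single_eq_of_ne hy]; simp) (by simp),
        Pi.single_eq_same] at this
      exact this
    have hsurj := Finsupp.linearCombination_id_surjective B K
    let i : OpDual τ K →ₗ[A] OpDual τ (K →₀ B) := OpDual.map τ (freeCover B K)
    have hi : Function.Injective i := OpDual.map_injective τ _ hsurj
    have hex := OpDual.map_exact_ker τ (freeCover B K)
    let a : Submodule A A := Submodule.span A
      (Set.range fun x : l.support => τ.symm (MulOpposite.op (l x)))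
    have ha : ∀ r ∈ a, ∃ ψ, i ψ = r • χ := fun r hr => by
      change r • χ ∈ LinearMap.range i
      induction hr using Submodule.span_induction with
      | mem r hr =>
        obtain ⟨x, rfl⟩ := hr
        apply (hex _).1
        ext v
        simpa using hχT x v
      | zero => simp
      | add r s _ _ hr hs => rw [add_smul]; exact add_mem hr hs
      | smul r s _ hs => rw [smul_eq_mul, mul_smul]; exact Submodule.smul_mem _ _ hs
    obtain ⟨φ, hφ⟩ := LinearMap.exists_factor_of_injective i hi
      (LinearMap.toSpanSingleton A _ χ ∘ₗ a.subtype) (fun r => ha r r.2)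
    obtain ⟨φ', hφ'⟩ := (h a (Submodule.fg_span (Set.finite_range _))).exists_extension φ
    have key : ∀ (x : l.support) (z : K →₀ B), χ (l x • z) = i (φ' 1) (l x • z) := fun x z => by
      have hx : τ.symm (MulOpposite.op (l x)) ∈ a := Submodule.subset_span ⟨x, rfl⟩
      have h1 := DFunLike.congr_fun (hφ ⟨_, hx⟩) z
      rw [← hφ', ← mul_one (Subtype.val _), ← smul_eq_mul, φ'.map_smul, i.map_smul] at h1
      simpa using h1.symm
    refine hc ?_
    have hl' : χ l = i (φ' 1) l := by
      have : l = ∑ x : l.support, l x • Finsupp.single (x : K) (1 : B) := by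
        rw [Finset.sum_coe_sort l.support fun x => l x • Finsupp.single x (1 : B)]
        simp only [Finsupp.smul_single, smul_eq_mul, mul_one]
        exact l.sum_single.symm
      rw [this, map_sum, map_sum]
      exact Finset.sum_congr rfl fun x _ => key x _
    rw [← hχ', hl', OpDual.map_apply, hl, map_zero]

end LocallySplitCover

section Aleph0Noetherian

variable {A B : Type u} [Ring A] [Ring B]

lemma extOneVanishes_opDual_syzygy_iff (τ : A ≃+* Bᵐᵒᵖ) {P M : Type u} [AddCommGroup P]
    [Module A P] [AddCommGroup M] [Module A M] (hP : Module.Projective A P) (f : P →ₗ[A] M)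
    (hf : Function.Surjective f) (K : ModuleCat.{u} B) :
    ExtOneVanishes A (LinearMap.ker f) (OpDual τ K) ↔
      ExtOneVanishes A M (OpDual τ (syzygy B K)) :=
  extOneVanishes_shift hP f hf (OpDual.injective_finsupp τ K) (OpDual.map τ (freeCover B K))
    (OpDual.map_injective τ _ (Finsupp.linearCombination_id_surjective B K)) _
    (OpDual.map_surjective τ _ (Submodule.subtype_injective _))
    (OpDual.map_exact_ker τ (freeCover B K))

lemma IsLeftAleph0Noetherian.exists_countable_of_le (hA : IsLeftAleph0Noetherian A) (n : ℕ)
    (K : Submodule A (ℕ →₀ A)) (hK : ∀ x ∈ K, ∀ i, n ≤ i → x i = 0) :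
    ∃ s : Set (ℕ →₀ A), s.Countable ∧ Submodule.span A s = K := by
  induction n generalizing K with
  | zero =>
    refine ⟨∅, Set.countable_empty, ?_⟩
    rw [Submodule.span_empty, eq_comm, eq_bot_iff]
    intro x hx
    ext i
    exact hK x hx i i.zero_le
  | succ n ih =>
    obtain ⟨s, hs, hsK⟩ := hA (K.map (Finsupp.lapply n))
    have hsK' : ∀ a ∈ s, ∃ x ∈ K, x n = a := fun a ha => by
      have : a ∈ K.map (Finsupp.lapply n) := hsK ▸ Submodule.subset_span ha
      simpa using this
    choose! g hgK hg using hsK'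
    obtain ⟨t, ht, htK⟩ := ih (K ⊓ LinearMap.ker (Finsupp.lapply n)) (fun x hx i hi => by
      rcases hi.eq_or_lt with rfl | hi
      · exact hx.2
      · exact hK x hx.1 i hi)
    have hle : Submodule.span A (g '' s) ≤ K :=
      Submodule.span_le.2 (by rintro _ ⟨a, ha, rfl⟩; exact hgK a ha)
    refine ⟨g '' s ∪ t, (hs.image g).union ht, ?_⟩
    rw [Submodule.span_union, htK]
    refine le_antisymm (sup_le hle inf_le_left) fun x hx => ?_
    have hmap : (Submodule.span A (g '' s)).map (Finsupp.lapply n) = K.map (Finsupp.lapply n) := by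
      rw [Submodule.map_span, ← hsK, Set.image_image]
      congr 1
      exact (Set.image_congr fun a ha => hg a ha).trans (Set.image_id s)
    obtain ⟨y, hy, hyx⟩ : x n ∈ (Submodule.span A (g '' s)).map (Finsupp.lapply n) :=
      hmap ▸ ⟨x, hx, rfl⟩
    rw [← add_sub_cancel y x]
    refine Submodule.add_mem_sup hy ⟨K.sub_mem hx (hle hy), ?_⟩
    replace hyx : y n = x n := hyx
    simp [hyx]

/-- Over a left `ℵ₀`-noetherian ring, submodules of countably generated free modules are countably
generated. -/
lemma IsLeftAleph0Noetherian.exists_surjective (hA : IsLeftAleph0Noetherian A)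
    (K : Submodule A (ℕ →₀ A)) :
    ∃ g : (ℕ →₀ A) →ₗ[A] K, Function.Surjective g := by
  have (n : ℕ) := hA.exists_countable_of_le n
    (K ⊓ ⨅ i ≥ n, LinearMap.ker (Finsupp.lapply i)) (fun x hx i hi => by
      have := hx.2
      simp only [SetLike.mem_coe, Submodule.mem_iInf] at this
      exact this i hi)
  choose s hs hsK using this
  have hc : ((insert 0 (⋃ n, s n) : Set (ℕ →₀ A))).Countable :=
    (Set.countable_iUnion hs).insert 0
  obtain ⟨w, hw⟩ := hc.exists_eq_range (Set.insert_nonempty _ _)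
  have hspan : Submodule.span A (Set.range w) = K := by
    rw [← hw, Submodule.span_insert_zero, Submodule.span_iUnion]
    simp only [hsK]
    refine le_antisymm (iSup_le fun n => inf_le_left) fun x hx => ?_
    refine Submodule.mem_iSup_of_mem (x.support.sup id + 1) ⟨hx, ?_⟩
    simp only [SetLike.mem_coe, Submodule.mem_iInf]
    intro i hi
    change x i = 0
    by_contra hxi
    have := Finset.le_sup (f := id) (Finsupp.mem_support_iff.2 hxi)
    simp only [id_eq] at this
    omega
  have hr : LinearMap.range (Finsupp.linearCombination A w) = K := by
    rw [Finsupp.range_linearCombination, hspan]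
  exact ⟨(Finsupp.linearCombination A w).codRestrict K fun x => hr ▸ ⟨x, rfl⟩, fun x => by
    obtain ⟨y, hy⟩ : (x : ℕ →₀ A) ∈ LinearMap.range (Finsupp.linearCombination A w) := hr ▸ x.2
    exact ⟨y, Subtype.ext hy⟩⟩

/-- The evaluation of a finite family of elements of a left `B`-module on a linear form over a
ring isomorphic to the opposite of `B`. -/
noncomputable def formEval (τ : A ≃+* Bᵐᵒᵖ) {I : Type u} [AddCommGroup I] [Module B I]
    (ρ : (ℕ →₀ A) →ₗ[A] A) : (ℕ →₀ I) →+ I :=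
  Finsupp.liftAddHom fun i =>
    DistribSMul.toAddMonoidHom I (τ (ρ (Finsupp.single i 1))).unop

/-- The balanced pairing of `ℕ →₀ A` with a left `B`-module. -/
noncomputable def tensorPair (τ : A ≃+* Bᵐᵒᵖ) {I : Type u} [AddCommGroup I] [Module B I] (x : I) :
    (ℕ →₀ A) →+ (ℕ →₀ I) :=
  Finsupp.mapRange.addMonoidHom
    { toFun := fun a => (τ a).unop • x
      map_zero' := by simp
      map_add' := by simp [add_smul] }

section

variable (τ : A ≃+* Bᵐᵒᵖ) {I : Type u} [AddCommGroup I] [Module B I]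

@[simp] lemma tensorPair_apply (x : I) (w : ℕ →₀ A) (i : ℕ) :
    tensorPair τ x w i = (τ (w i)).unop • x := rfl

@[simp] lemma tensorPair_single (x : I) (i : ℕ) (a : A) :
    tensorPair τ x (Finsupp.single i a) = Finsupp.single i ((τ a).unop • x) :=
  Finsupp.mapRange_single (hf := by simp)

lemma tensorPair_smul (x : I) (a : A) (w : ℕ →₀ A) :
    tensorPair τ x (a • w) = tensorPair τ ((τ a).unop • x) w := by
  ext i
  simp [mul_smul]

lemma tensorPair_add (x y : I) (w : ℕ →₀ A) :
    tensorPair τ (x + y) w = tensorPair τ x w + tensorPair τ y w := by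
  ext i
  simp

lemma formEval_single (ρ : (ℕ →₀ A) →ₗ[A] A) (i : ℕ) (x : I) :
    formEval τ ρ (Finsupp.single i x) = (τ (ρ (Finsupp.single i 1))).unop • x :=
  Finsupp.liftAddHom_apply_single _ _ _

lemma formEval_tensorPair (ρ : (ℕ →₀ A) →ₗ[A] A) (w : ℕ →₀ A) (x : I) :
    formEval τ ρ (tensorPair τ x w) = (τ (ρ w)).unop • x := by
  induction w using Finsupp.induction_linear with
  | zero => simp
  | add v w hv hw => simp [hv, hw, add_smul]
  | single i a =>
    rw [tensorPair_single, formEval_single, ← mul_smul, ← MulOpposite.unop_mul, ← map_mul,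
      ← smul_eq_mul, ← map_smul, Finsupp.smul_single, smul_eq_mul, mul_one]

/-- The map induced on `ℕ →₀ I` by an endomorphism of `ℕ →₀ A`. -/
noncomputable def tensorMap (h : (ℕ →₀ A) →ₗ[A] (ℕ →₀ A)) : (ℕ →₀ I) →+ (ℕ →₀ I) :=
  Finsupp.liftAddHom fun i =>
    { toFun := fun x => tensorPair τ x (h (Finsupp.single i 1))
      map_zero' := by ext; simp
      map_add' := fun x y => tensorPair_add τ x y _ }

lemma tensorMap_single (h : (ℕ →₀ A) →ₗ[A] (ℕ →₀ A)) (i : ℕ) (x : I) :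
    tensorMap τ h (Finsupp.single i x) = tensorPair τ x (h (Finsupp.single i 1)) :=
  Finsupp.liftAddHom_apply_single _ _ _

lemma tensorMap_tensorPair (h : (ℕ →₀ A) →ₗ[A] (ℕ →₀ A)) (w : ℕ →₀ A) (x : I) :
    tensorMap τ h (tensorPair τ x w) = tensorPair τ x (h w) := by
  induction w using Finsupp.induction_linear with
  | zero => simp
  | add v w hv hw => simp [hv, hw]
  | single i a =>
    rw [tensorPair_single, tensorMap_single, ← tensorPair_smul, ← map_smul, Finsupp.smul_single,
      smul_eq_mul, mul_one]

lemma formEval_tensorMap (ρ : (ℕ →₀ A) →ₗ[A] A) (h : (ℕ →₀ A) →ₗ[A] (ℕ →₀ A)) (z : ℕ →₀ I) :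
    formEval τ ρ (tensorMap τ h z) = formEval τ (ρ ∘ₗ h) z := by
  induction z using Finsupp.induction_linear with
  | zero => simp
  | add v w hv hw => simp [hv, hw]
  | single i x => rw [tensorMap_single, formEval_tensorPair, formEval_single]; rfl

lemma formEval_sub (ρ ρ' : (ℕ →₀ A) →ₗ[A] A) (z : ℕ →₀ I) :
    formEval τ (ρ - ρ') z = formEval τ ρ z - formEval τ ρ' z := by
  induction z using Finsupp.induction_linear with
  | zero => simp
  | add v w hv hw => simp only [map_add, hv, hw]; abel
  | single i x => simp [formEval_single, sub_smul]

end

lemma eq_sum_tensorPair_or_exists_formEval_ne_zero (τ : A ≃+* Bᵐᵒᵖ) {I : Type u}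
    [AddCommGroup I] [Module B I] (hI : Module.Injective B I) (k : ℕ) (l : ℕ → (ℕ →₀ A))
    (z : ℕ →₀ I) :
    (∃ x : Fin k → I, z = ∑ j, tensorPair τ (x j) (l j)) ∨
      ∃ ρ : (ℕ →₀ A) →ₗ[A] A, (∀ j < k, ρ (l j) = 0) ∧ formEval τ ρ z ≠ 0 := by
  classical
  let Λ : (ℕ →₀ B) →ₗ[B] (Fin k → B) :=
    Finsupp.linearCombination B fun i j => (τ (l j i)).unop
  let ζ : (ℕ →₀ B) →ₗ[B] I := Finsupp.linearCombination B z
  by_cases h : ∀ β, Λ β = 0 → ζ β = 0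
  · left
    obtain ⟨y, hy⟩ := LinearMap.exists_factor_of_surjective Λ.rangeRestrict
      Λ.surjective_rangeRestrict ζ (fun β hβ => h β (congrArg Subtype.val hβ))
    obtain ⟨x, hx⟩ := hI.out _ (Submodule.subtype_injective (LinearMap.range Λ)) y
    refine ⟨fun j => x (Pi.single j 1), ?_⟩
    ext i
    have h1 : z i = x (Λ (Finsupp.single i 1)) := by
      have : z i = ζ (Finsupp.single i 1) := by simp [ζ]
      rw [this, ← hy, ← hx]
      rfl
    have h2 : Λ (Finsupp.single i 1) =
        ∑ j : Fin k, (τ (l j i)).unop • (Pi.single j 1 : Fin k → B) := by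
      rw [show Λ (Finsupp.single i 1) = fun j : Fin k => (τ (l j i)).unop by simp [Λ]]
      exact pi_eq_sum_univ' _
    rw [h1, h2, map_sum, Finsupp.finsetSum_apply]
    simp
  · right
    push Not at h
    obtain ⟨β, hβ, hz⟩ := h
    have key : ∀ w : ℕ →₀ A, (τ (Finsupp.linearCombination A
        (fun i => τ.symm (MulOpposite.op (β i))) w)).unop =
          β.sum fun i b => b * (τ (w i)).unop := by
      intro w
      induction w using Finsupp.induction_linear with
      | zero => simp
      | add v w hv hw => simp [hv, hw, mul_add, Finsupp.sum_add]
      | single i a =>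
        simp only [Finsupp.linearCombination_single, smul_eq_mul, map_mul,
          RingEquiv.apply_symm_apply, MulOpposite.unop_mul, MulOpposite.unop_op]
        rw [Finsupp.sum, Finset.sum_eq_single i]
        · simp
        · intro j _ hj
          simp [Finsupp.single_eq_of_ne hj]
        · intro hi
          simp [Finsupp.notMem_support_iff.1 hi]
    refine ⟨Finsupp.linearCombination A fun i => τ.symm (MulOpposite.op (β i)), fun j hj => ?_, ?_⟩
    · have hβj : Λ β ⟨j, hj⟩ = 0 := congrFun hβ ⟨j, hj⟩
      apply τ.injective
      apply MulOpposite.unop_injective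
      rw [key, map_zero, MulOpposite.unop_zero]
      rw [← hβj]
      simp [Λ, Finsupp.linearCombination_apply, Finsupp.sum, Finset.sum_apply]
    · convert hz
      have : ∀ z : ℕ →₀ I, formEval τ (Finsupp.linearCombination A
          fun i => τ.symm (MulOpposite.op (β i))) z = Finsupp.linearCombination B z β := by
        intro z
        induction z using Finsupp.induction_linear with
        | zero => simp
        | add v w hv hw =>
          simp [hv, hw, Finsupp.linearCombination_apply, Finsupp.sum, Finset.sum_add_distrib]
        | single i x =>
          rw [formEval_single, Finsupp.linearCombination_single, one_smul,
            RingEquiv.apply_symm_apply, MulOpposite.unop_op, Finsupp.linearCombination_apply,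
            Finsupp.sum, Finset.sum_eq_single i]
          · simp
          · intro j _ hj
            simp [Finsupp.single_eq_of_ne hj]
          · intro hi
            simp [Finsupp.notMem_support_iff.1 hi]
      exact this z

/-- Over a left `ℵ₀`-noetherian ring, countably generated modules with enough vanishing against
free modules have no extensions by duals of injective modules. -/
lemma extOneVanishes_opDual_of_injective (hA : IsLeftAleph0Noetherian A) (τ : A ≃+* Bᵐᵒᵖ)
    {I : Type u} [AddCommGroup I] [Module B I] (hI : Module.Injective B I) {M : Type u}
    [AddCommGroup M] [Module A M] (f : (ℕ →₀ A) →ₗ[A] M) (hf : Function.Surjective f)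
    (hM : ExtOneVanishes A M A) (hK : ExtOneVanishes A (LinearMap.ker f) (ℕ →₀ A)) :
    ExtOneVanishes A M (OpDual τ I) := by
  rw [extOneVanishes_iff_extend inferInstance f hf] at hM ⊢
  intro φ
  obtain ⟨g, hg⟩ := hA.exists_surjective (LinearMap.ker f)
  obtain ⟨g', hg'⟩ := hA.exists_surjective (LinearMap.ker g)
  let h : (ℕ →₀ A) →ₗ[A] (ℕ →₀ A) := (LinearMap.ker f).subtype ∘ₗ g
  let G : (ℕ →₀ A) →ₗ[A] OpDual τ I := φ ∘ₗ g
  let l : ℕ → (ℕ →₀ A) := fun j => g' (Finsupp.single j 1)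
  have hl : ∀ j, g (l j) = 0 := fun j => (g' (Finsupp.single j 1)).2
  let γ : (ℕ →₀ I) →+ AddCircle (1 : ℚ) :=
    Finsupp.liftAddHom fun i => (G (Finsupp.single i 1) : I →+ AddCircle (1 : ℚ))
  have hγs : ∀ i y, γ (Finsupp.single i y) = G (Finsupp.single i 1) y := fun _ _ =>
    Finsupp.liftAddHom_apply_single _ _ _
  have hγ : ∀ x w, γ (tensorPair τ x w) = G w x := by
    intro x w
    induction w using Finsupp.induction_linear with
    | zero => simp
    | add v w hv hw => rw [map_add, map_add, hv, hw, map_add]; rfl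
    | single i a =>
      have hG : G (Finsupp.single i a) = a • G (Finsupp.single i 1) := by
        rw [← map_smul, Finsupp.smul_single, smul_eq_mul, mul_one]
      rw [tensorPair_single, hγs, hG]
      rfl
  have hker : ∀ z, tensorMap τ h z = 0 → γ z = 0 := by
    intro z hz
    by_contra hγz
    have hρ : ∀ k, ∃ ρ : (ℕ →₀ A) →ₗ[A] A, (∀ j < k, ρ (l j) = 0) ∧ formEval τ ρ z ≠ 0 := by
      intro k
      refine (eq_sum_tensorPair_or_exists_formEval_ne_zero τ hI k l z).resolve_left ?_
      rintro ⟨x, rfl⟩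
      apply hγz
      rw [map_sum]
      refine Finset.sum_eq_zero fun j _ => ?_
      rw [hγ]
      simp only [G, LinearMap.comp_apply, hl, map_zero]
      rfl
    choose ρ hρl hρz using hρ
    have hfinite : ∀ w : LinearMap.ker g, ∃ n, ∀ k, n ≤ k → ρ k w = 0 := by
      intro w
      obtain ⟨v, rfl⟩ := hg' w
      induction v using Finsupp.induction_linear with
      | zero => exact ⟨0, by simp⟩
      | add v w hv hw =>
        obtain ⟨m, hm⟩ := hv
        obtain ⟨n, hn⟩ := hw
        refine ⟨max m n, fun k hk => ?_⟩
        rw [map_add, Submodule.coe_add, map_add, hm k ((le_max_left _ _).trans hk),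
          hn k ((le_max_right _ _).trans hk), add_zero]
      | single i a =>
        refine ⟨i + 1, fun k hk => ?_⟩
        rw [← mul_one a, ← smul_eq_mul, ← Finsupp.smul_single, map_smul, Submodule.coe_smul,
          map_smul, hρl k i hk, smul_zero]
    let ev : (ℕ →₀ A) →ₗ[A] (ℕ → A) := Finsupp.lcoeFun
    let pr : LinearMap.ker g →ₗ[A] (ℕ → A) :=
      LinearMap.pi fun k => ρ k ∘ₗ (LinearMap.ker g).subtype
    obtain ⟨Φ, hΦ⟩ := LinearMap.exists_factor_of_injective ev DFunLike.coe_injective pr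
      (fun w : LinearMap.ker g => by
        obtain ⟨n, hn⟩ := hfinite w
        refine ⟨Finsupp.onFinset (Finset.range n) (fun k => ρ k w) fun k hk => ?_, ?_⟩
        · by_contra hkn
          exact hk (hn k (by simpa using hkn))
        · ext j; rfl)
    obtain ⟨Ψ, hΨ⟩ := hK _ g hg Φ
    have hΨ' : ∀ w, g w = 0 → ∀ k, Ψ w k = ρ k w := fun w hw k => by
      rw [hΨ ⟨w, hw⟩]
      exact congrFun (hΦ ⟨w, hw⟩) k
    have heq : ∀ k, formEval τ (ρ k) z = formEval τ (Finsupp.lapply k ∘ₗ Ψ) z := fun k => by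
      let s : (ℕ →₀ A) →ₗ[A] A := ρ k - Finsupp.lapply k ∘ₗ Ψ
      have hs : ∀ w, g w = 0 → s w = 0 := fun w hw => by simp [s, hΨ' w hw]
      obtain ⟨r, hr⟩ := LinearMap.exists_factor_of_surjective (X := ℕ →₀ A)
        (M := LinearMap.ker f) (N := A) g hg s hs
      obtain ⟨r', hr'⟩ := hM r
      have : ρ k - Finsupp.lapply k ∘ₗ Ψ = r' ∘ₗ h := by
        refine LinearMap.ext fun w => ?_
        rw [← hr, ← hr']
        rfl
      rw [← sub_eq_zero, ← formEval_sub, this, ← formEval_tensorMap, hz, map_zero]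
    obtain ⟨n, hn⟩ : ∃ n, ∀ i ∈ z.support, ∀ k, n ≤ k → Ψ (Finsupp.single i 1) k = 0 := by
      refine ⟨z.support.sup fun i => (Ψ (Finsupp.single i 1)).support.sup id + 1,
        fun i hi k hk => ?_⟩
      by_contra hne
      have h1 := Finset.le_sup (f := id) (Finsupp.mem_support_iff.2 hne)
      have h2 := (Finset.le_sup (f := fun i => (Ψ (Finsupp.single i 1)).support.sup id + 1)
        hi).trans hk
      simp only [id_eq] at h1 h2
      omega
    apply hρz n
    rw [heq, formEval, Finsupp.liftAddHom_apply]
    refine Finset.sum_eq_zero fun i hi => ?_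
    simp [hn i hi n le_rfl]
  obtain ⟨δ, hδ⟩ := exists_character_factor _ γ hker
  refine ⟨
    { toFun := fun w =>
        (⟨⟨fun x => δ (tensorPair τ x w), by
          rw [show tensorPair τ (0 : I) w = 0 by ext; simp, map_zero]⟩,
          fun x y => by simp only [tensorPair_add, map_add]⟩ : I →+ AddCircle (1 : ℚ))
      map_add' := fun v w => OpDual.ext fun x => by
        change δ _ = δ _ + δ _
        rw [map_add, map_add]
      map_smul' := fun a w => OpDual.ext fun x => by
        change δ _ = δ _
        rw [tensorPair_smul]
        rfl }, fun y => OpDual.ext fun x => ?_⟩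
  obtain ⟨w, rfl⟩ := hg y
  change δ (tensorPair τ x (h w)) = G w x
  rw [← tensorMap_tensorPair, hδ, hγ]

lemma extOneVanishes_opDual_syzygy (hA : IsLeftAleph0Noetherian A) (τ : A ≃+* Bᵐᵒᵖ)
    (I : ModuleCat.{u} B) (hI : Module.Injective B I) (k : ℕ) {M : Type u}
    [AddCommGroup M] [Module A M] (f : (ℕ →₀ A) →ₗ[A] M) (hf : Function.Surjective f)
    (hM : ∀ j, k ≤ j →
      ExtOneVanishes A M ((cosyzygy A)^[j] (ModuleCat.of A (ℕ →₀ A)))) :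
    ExtOneVanishes A M (OpDual τ ((syzygy B)^[k] I)) := by
  induction k generalizing M with
  | zero =>
    refine extOneVanishes_opDual_of_injective hA τ hI f hf ?_ ?_
    · exact (hM 0 le_rfl).of_retract (Finsupp.lsingle 0) (Finsupp.lapply 0) fun c =>
        Finsupp.single_eq_same
    · exact (extOneVanishes_ker_iff inferInstance f hf (ModuleCat.of A (ℕ →₀ A))).2
        (hM 1 zero_le_one)
  | succ k ih =>
    obtain ⟨g, hg⟩ := hA.exists_surjective (LinearMap.ker f)
    rw [Function.iterate_succ_apply', ← extOneVanishes_opDual_syzygy_iff τ inferInstance f hf]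
    refine ih g hg fun j hj => ?_
    rw [extOneVanishes_ker_iff inferInstance f hf, ← Function.iterate_succ_apply' (cosyzygy A)]
    exact hM (j + 1) (by omega)

/-- The syzygies of injective modules have locally split presentations, provided that the opposite
ring is `ℵ₀`-noetherian and that countable free modules over it have finite injective dimension. -/
theorem LocallySplitCover.syzygy_of_injective (hA : IsLeftAleph0Noetherian A) (τ : A ≃+* Bᵐᵒᵖ)
    (n : ℕ) (h : ∀ (M : ModuleCat.{u} A) (j : ℕ), n ≤ j →
      ExtOneVanishes A M ((cosyzygy A)^[j] (ModuleCat.of A (ℕ →₀ A))))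
    (I : ModuleCat.{u} B) (hI : Module.Injective B I) :
    LocallySplitCover B ((syzygy B)^[n] I) := by
  refine .of_extOneVanishes τ fun a _ => ?_
  refine extOneVanishes_opDual_syzygy hA τ I hI n (a.mkQ ∘ₗ Finsupp.lapply 0) ?_
    fun j hj => h (ModuleCat.of A (A ⧸ a)) j hj
  exact a.mkQ_surjective.comp fun x => ⟨Finsupp.single 0 x, by simp⟩

end Aleph0Noetherian

section Restriction

variable {R : Type u} [Ring R] {s : Subring R}

lemma Finsupp.sum_fin_card_support {α M N : Type*} [Zero M] [AddCommMonoid N] (w : α →₀ M)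
    (g : α → M → N) :
    ∑ i, g (w.support.equivFin.symm i) (w (w.support.equivFin.symm i)) = w.sum g :=
  (Equiv.sum_comp w.support.equivFin.symm fun x : w.support => g x (w x)).trans
    (Finset.sum_coe_sort w.support fun x => g x (w x))

/-- Restriction of scalars along a right flat ring extension preserves injectivity. -/
lemma RightFlatOverSubring.injective (hs : RightFlatOverSubring R s) {I : Type u}
    [AddCommGroup I] [Module R I] (hI : Module.Injective R I) : Module.Injective s I := by
  refine Module.Baer.injective fun a φ => ?_
  let q : (a →₀ R) →ₗ[R] R := Finsupp.linearCombination R fun x => ((x : s) : R)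
  let ψ : (a →₀ R) →ₗ[R] I := Finsupp.linearCombination R φ
  have hψ : ∀ w, q w = 0 → ψ w = 0 := by
    intro w hw
    let e := w.support.equivFin.symm
    obtain ⟨m, c, d, hc, hd⟩ := hs _ (fun i => ((e i : a) : s)) (fun i => w (e i)) (by
      rw [Finsupp.sum_fin_card_support w fun x b => b * ((x : s) : R)]
      exact hw)
    change w.sum (fun x b => b • φ x) = 0
    rw [← Finsupp.sum_fin_card_support w fun x b => b • φ x]
    have hφ : ∀ j, ∑ i, ((d j i : s) : R) • φ (e i) = 0 := fun j => by
      have : ∑ i, d j i • (e i : a) = 0 := Subtype.ext (by simpa using hd j)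
      rw [← map_zero φ, ← this, map_sum]
      exact Finset.sum_congr rfl fun i _ => (map_smul φ (d j i) (e i : a)).symm
    have hc' : ∀ i, w (e i) = ∑ j, c j * ((d j i : s) : R) := hc
    change ∑ i, w (e i) • φ (e i) = 0
    simp only [hc', Finset.sum_smul, mul_smul]
    rw [Finset.sum_comm]
    simp only [← Finset.smul_sum, hφ, smul_zero, Finset.sum_const_zero]
  obtain ⟨y, hy⟩ := LinearMap.exists_factor_of_surjective (X := a →₀ R) (N := I) q.rangeRestrict
    q.surjective_rangeRestrict ψ (fun w hw => hψ w (congrArg Subtype.val hw))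
  obtain ⟨x, hx⟩ := hI.out _ (Submodule.subtype_injective (LinearMap.range q)) y
  let inc : s →ₗ[s] R := LinearMap.toSpanSingleton s R 1
  refine ⟨x.restrictScalars s ∘ₗ inc, fun r hr => ?_⟩
  have hq : q (Finsupp.single ⟨r, hr⟩ 1) = inc r := by
    simp [q, inc, Subring.smul_def]
  have hψr : ψ (Finsupp.single ⟨r, hr⟩ 1) = φ ⟨r, hr⟩ := by simp [ψ]
  change x (inc r) = _
  rw [← hψr, ← hy, ← hx, ← hq]
  rfl

lemma InjDimLE.extOneVanishes_restrictScalars (hs : RightFlatOverSubring R s) (n : ℕ)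
    (N : Type u) [AddCommGroup N] [Module R N] (h : InjDimLE R n N) (M : ModuleCat.{u} s) :
    ExtOneVanishes s ((syzygy s)^[n] M) N := by
  induction n generalizing N M with
  | zero => exact .of_injective (hs.injective h)
  | succ n ih =>
    rcases h with h | ⟨J, f, hJ, hf, h⟩
    · exact .of_injective (hs.injective h)
    · obtain ⟨C, p, hp, hfp, hC⟩ : ∃ (C : ModuleCat.{u} R) (p : J →ₗ[R] C),
          Function.Surjective p ∧ Function.Exact f p ∧ InjDimLE R n C :=
        ⟨ModuleCat.of R (J ⧸ LinearMap.range f), (LinearMap.range f).mkQ,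
          Submodule.mkQ_surjective _, LinearMap.exact_map_mkQ_range f, h⟩
      rw [Function.iterate_succ_apply']
      exact (extOneVanishes_shift inferInstance (freeCover s ((syzygy s)^[n] M))
        (Finsupp.linearCombination_id_surjective s _) (hs.injective hJ) (f.restrictScalars s) hf
        (p.restrictScalars s) hp hfp).2 (ih C hC M)

lemma InjDimLE.extOneVanishes_cosyzygy_finsupp (hs : RightFlatOverSubring R s)
    (hπ : ∃ π : R →ₗ[s] s, ∀ a : s, π a = a) (m : ℕ) (h : InjDimLE R m (ℕ →₀ R))
    (M : ModuleCat.{u} s) (j : ℕ) (hj : m ≤ j) :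
    ExtOneVanishes s M ((cosyzygy s)^[j] (ModuleCat.of s (ℕ →₀ s))) := by
  obtain ⟨π, hπ⟩ := hπ
  obtain ⟨j, rfl⟩ := Nat.exists_eq_add_of_le hj
  rw [← extOneVanishes_syzygy_iterate_iff, Function.iterate_add_apply]
  let inc : s →ₗ[s] R := LinearMap.toSpanSingleton s R 1
  have hinc : ∀ a, π (inc a) = a := fun a => by
    rw [show inc a = a by simp [inc, Subring.smul_def], hπ]
  refine (h.extOneVanishes_restrictScalars hs m (ℕ →₀ R) ((syzygy s)^[j] M)).of_retract
    (Finsupp.mapRange.linearMap inc) (Finsupp.mapRange.linearMap π) fun c => ?_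
  ext i
  simp [hinc]

end Restriction

section FilteredUnion

variable {R : Type u} [Ring R]

lemma LocallySplitCover.finitelySplit_ker {K : Type u} [AddCommGroup K] [Module R K]
    (hK : LocallySplitCover R K) :
    FinitelySplit R (LinearMap.ker (freeCover R K) : Set (K →₀ R)) := by
  classical
  intro T hT
  obtain ⟨θ, hθ, hθT⟩ : ∃ θ : (K →₀ R) →ₗ[R] (K →₀ R),
      (∀ z, freeCover R K (θ z) = 0) ∧ ∀ t ∈ T, θ t = t := by
    induction T using Finset.induction_on with
    | empty => exact ⟨0, by simp, by simp⟩
    | insert u T _ ih =>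
      rw [Finset.coe_insert, Set.insert_subset_iff] at hT
      obtain ⟨θ, hθ, hθT⟩ := ih hT.2
      have hu : freeCover R K u = 0 := hT.1
      obtain ⟨θ', hθ', hθu⟩ := hK (u - θ u) (by rw [map_sub, hu, hθ, sub_zero])
      refine ⟨θ + θ' ∘ₗ (LinearMap.id - θ), fun z => ?_, fun t ht => ?_⟩
      · rw [LinearMap.add_apply, map_add, hθ, LinearMap.comp_apply, hθ', add_zero]
      · rcases Finset.mem_insert.1 ht with rfl | ht
        · simp [hθu]
        · simp [hθT t ht]
  let F : Finset K := T.biUnion Finsupp.support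
  let g : K → (K →₀ R) := fun x => if x ∈ F then θ (Finsupp.single x 1) else 0
  have hg : ∀ x ∈ F, g x = θ (Finsupp.single x 1) := fun x hx => if_pos hx
  refine ⟨F.image g, fun v hv => ?_, Finsupp.linearCombination R g, fun z => ?_, fun t ht => ?_⟩
  · obtain ⟨x, hx, rfl⟩ := Finset.mem_image.1 (Finset.mem_coe.1 hv)
    rw [hg x hx]
    exact hθ _
  · refine Submodule.sum_mem _ fun x _ => Submodule.smul_mem _ _ ?_
    by_cases hx : x ∈ F
    · exact Submodule.subset_span (Finset.mem_coe.2 (Finset.mem_image_of_mem g hx))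
    · simp [g, hx]
  · nth_rw 2 [← hθT t ht]
    nth_rw 2 [← t.sum_single]
    rw [Finsupp.linearCombination_apply, map_finsuppSum]
    refine Finset.sum_congr rfl fun x hx => ?_
    change t x • g x = θ (Finsupp.single x (t x))
    rw [hg x (Finset.mem_biUnion.2 ⟨t, ht, hx⟩), ← map_smul, Finsupp.smul_single, smul_eq_mul,
      mul_one]

variable {s : Subring R} {X M : Type u} [AddCommGroup X] [Module s X] [AddCommGroup M] [Module R M]

/-- The map induced between free modules by a semilinear map. -/
noncomputable def finsuppMap (j : X →ₛₗ[s.subtype] M) : (X →₀ s) →ₛₗ[s.subtype] (M →₀ R) :=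
  { (Finsupp.mapDomain.addMonoidHom j).comp
      (Finsupp.mapRange.addMonoidHom (s.subtype : s →+ R)) with
    map_smul' := fun a w => by
      induction w using Finsupp.induction_linear with
      | zero => simp
      | add v w hv hw =>
        simp only [ZeroHom.toFun_eq_coe, AddMonoidHom.toZeroHom_coe, smul_add, map_add] at *
        rw [hv, hw]
      | single x b =>
        simp [-Finsupp.single_mul] }

@[simp] lemma finsuppMap_single (j : X →ₛₗ[s.subtype] M) (x : X) (a : s) :
    finsuppMap j (Finsupp.single x a) = Finsupp.single (j x) (a : R) := by
  simp [finsuppMap]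

lemma finsuppMap_injective (j : X →ₛₗ[s.subtype] M) (hj : Function.Injective j) :
    Function.Injective (finsuppMap j) :=
  (Finsupp.mapDomain_injective hj).comp
    (Finsupp.mapRange_injective _ (map_zero _) Subtype.val_injective)

lemma freeCover_finsuppMap (j : X →ₛₗ[s.subtype] M) (w : X →₀ s) :
    freeCover R M (finsuppMap j w) = j (freeCover s X w) := by
  induction w using Finsupp.induction_linear with
  | zero => simp
  | add v w hv hw => simp [hv, hw]
  | single x a => simp

lemma mem_range_finsuppMap (j : X →ₛₗ[s.subtype] M) {w : M →₀ R} :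
    w ∈ Set.range (finsuppMap j) ↔
      ∀ x ∈ w.support, x ∈ Set.range j ∧ w x ∈ s := by
  classical
  constructor
  · rintro ⟨v, rfl⟩ x hx
    constructor
    · obtain ⟨y, -, rfl⟩ := Finset.mem_image.1 (Finsupp.mapDomain_support hx)
      exact ⟨y, rfl⟩
    · clear hx
      induction v using Finsupp.induction_linear with
      | zero => simp
      | add v w hv hw =>
        rw [map_add, Finsupp.add_apply]
        exact s.add_mem hv hw
      | single y a =>
        rw [finsuppMap_single, Finsupp.single_apply]
        split_ifs
        · exact a.2
        · exact s.zero_mem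
  · intro h
    have hy : ∀ x ∈ w.support, ∃ y, j y = x := fun x hx => (h x hx).1
    choose! y hy using hy
    rw [← w.sum_single]
    refine ⟨∑ x : w.support, Finsupp.single (y x) ⟨w x, (h x x.2).2⟩, ?_⟩
    rw [map_sum]
    refine (Finset.sum_congr rfl fun x _ => ?_).trans
      (Finset.sum_coe_sort w.support fun x => Finsupp.single x (w x))
    rw [finsuppMap_single, hy x x.2]

/-- The map induced between syzygies by a semilinear map. -/
noncomputable def syzygyMap {X : ModuleCat.{u} s} {M : ModuleCat.{u} R} (j : X →ₛₗ[s.subtype] M) :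
    syzygy s X →ₛₗ[s.subtype] syzygy R M :=
  ((finsuppMap j).comp (LinearMap.ker (freeCover s X)).subtype).codRestrict
    (LinearMap.ker (freeCover R M)) fun w => by
      rw [LinearMap.mem_ker, LinearMap.comp_apply, freeCover_finsuppMap, Submodule.subtype_apply,
        LinearMap.mem_ker.1 w.2, map_zero]

variable {ι : Type u} {S : ι → Subring R}

/-- The `R`-module `M` is the directed union of the images of the `S i`-modules `X i`. -/
structure IsFilteredUnion {M : ModuleCat.{u} R} {X : ∀ i, ModuleCat.{u} (S i)}
    (j : ∀ i, X i →ₛₗ[(S i).subtype] M) : Prop where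
  injective : ∀ i, Function.Injective (j i)
  mono : ∀ {i k}, S i ≤ S k → Set.range (j i) ⊆ Set.range (j k)
  cover : ∀ x, ∃ i, x ∈ Set.range (j i)

namespace IsFilteredUnion

variable {M : ModuleCat.{u} R} {X : ∀ i, ModuleCat.{u} (S i)} {j : ∀ i, X i →ₛₗ[(S i).subtype] M}

lemma exists_mem_range_finsuppMap [Nonempty ι] (h : IsFilteredUnion j)
    (hdir : Directed (· ≤ ·) S) (hcover : ∀ x : R, ∃ i, x ∈ S i) (w : M →₀ R) :
    ∃ i, w ∈ Set.range (finsuppMap (j i)) := by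
  classical
  simp only [mem_range_finsuppMap]
  induction w.support using Finset.induction_on with
  | empty => exact ⟨Classical.arbitrary ι, by simp⟩
  | insert x F _ ih =>
    obtain ⟨i, hi⟩ := ih
    obtain ⟨k, hk⟩ := h.cover x
    obtain ⟨l, hl⟩ := hcover (w x)
    obtain ⟨p, hip, hkp⟩ := hdir i k
    obtain ⟨q, hpq, hlq⟩ := hdir p l
    refine ⟨q, fun y hy => ?_⟩
    rcases Finset.mem_insert.1 hy with rfl | hy
    · exact ⟨h.mono (hkp.trans hpq) hk, hlq hl⟩
    · exact ⟨h.mono (hip.trans hpq) (hi y hy).1, hpq (hip (hi y hy).2)⟩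

lemma syzygy [Nonempty ι] (h : IsFilteredUnion j) (hdir : Directed (· ≤ ·) S)
    (hcover : ∀ x : R, ∃ i, x ∈ S i) : IsFilteredUnion fun i => syzygyMap (j i) := by
  have hmem : ∀ i (w : _root_.syzygy R M),
      w ∈ Set.range (syzygyMap (j i)) ↔ w.1 ∈ Set.range (finsuppMap (j i)) := by
    refine fun i w => ⟨?_, ?_⟩
    · rintro ⟨v, rfl⟩
      exact ⟨v.1, rfl⟩
    · rintro ⟨v, hv⟩
      have hv0 : freeCover (S i) (X i) v = 0 := h.injective i (by
        rw [← freeCover_finsuppMap, hv, map_zero]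
        exact w.2)
      exact ⟨⟨v, hv0⟩, Subtype.ext hv⟩
  refine ⟨fun i v w hvw => ?_, fun {i k} hik w hw => ?_, fun w => ?_⟩
  · exact Subtype.ext (finsuppMap_injective (j i) (h.injective i) (congrArg Subtype.val hvw))
  · rw [hmem, mem_range_finsuppMap] at hw ⊢
    exact fun x hx => ⟨h.mono hik (hw x hx).1, hik (hw x hx).2⟩
  · obtain ⟨i, hi⟩ := h.exists_mem_range_finsuppMap hdir hcover w.1
    exact ⟨i, (hmem i w).2 hi⟩

lemma syzygy_iterate [Nonempty ι] (h : IsFilteredUnion j) (hdir : Directed (· ≤ ·) S)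
    (hcover : ∀ x : R, ∃ i, x ∈ S i) (n : ℕ) :
    ∃ j' : ∀ i, (_root_.syzygy (S i))^[n] (X i) →ₛₗ[(S i).subtype] (_root_.syzygy R)^[n] M,
      IsFilteredUnion j' := by
  induction n generalizing M X j with
  | zero => exact ⟨j, h⟩
  | succ n ih => exact ih (h.syzygy hdir hcover)

lemma locallySplitCover [Nonempty ι] (h : IsFilteredUnion j) (hdir : Directed (· ≤ ·) S)
    (hcover : ∀ x : R, ∃ i, x ∈ S i) (hX : ∀ i, LocallySplitCover (S i) (X i)) :
    LocallySplitCover R M := by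
  classical
  intro l hl
  obtain ⟨i, v, rfl⟩ := h.exists_mem_range_finsuppMap hdir hcover l
  obtain ⟨θ, hθ, hθv⟩ := hX i v (h.injective i (by rw [← freeCover_finsuppMap, hl, map_zero]))
  let g : M → (M →₀ R) := fun x =>
    if hx : x ∈ Set.range (j i) then finsuppMap (j i) (θ (Finsupp.single hx.choose 1)) else 0
  have hg : ∀ y, g (j i y) = finsuppMap (j i) (θ (Finsupp.single y 1)) := fun y => by
    have hy : j i y ∈ Set.range (j i) := ⟨y, rfl⟩
    simp only [g, dif_pos hy, h.injective i hy.choose_spec]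
  refine ⟨Finsupp.linearCombination R g, fun z => ?_, ?_⟩
  · have hzero : freeCover R M ∘ g = 0 := funext fun x => by
      by_cases hx : x ∈ Set.range (j i)
      · obtain ⟨y, rfl⟩ := hx
        rw [Function.comp_apply, hg, freeCover_finsuppMap, hθ, map_zero, Pi.zero_apply]
      · simp only [Function.comp_apply, g, dif_neg hx, map_zero, Pi.zero_apply]
    rw [Finsupp.apply_linearCombination, hzero]
    simp
  · have key : ∀ w, Finsupp.linearCombination R g (finsuppMap (j i) w) =
        finsuppMap (j i) (θ w) := fun w => by
      induction w using Finsupp.induction_linear with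
      | zero => simp
      | add v w hv hw => simp only [map_add, hv, hw]
      | single y a =>
        have ha : θ (Finsupp.single y a) = a • θ (Finsupp.single y 1) := by
          rw [← map_smul, Finsupp.smul_single, smul_eq_mul, mul_one]
        rw [finsuppMap_single, Finsupp.linearCombination_single, hg, ha, map_smulₛₗ]
        rfl
    rw [key, hθv]

end IsFilteredUnion

end FilteredUnion

section SpliLeSilp

variable {R : Type u} [Ring R]

lemma LocallySplitCover.extOneVanishes {n : ℕ}
    (H : ∀ (M : ModuleCat.{u} R) (X : Type u), ExtOneVanishes R ((syzygy R)^[n] M) (X →₀ R))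
    {K : Type u} [AddCommGroup K] [Module R K] (hK : LocallySplitCover R K) (N : ModuleCat.{u} R) :
    ExtOneVanishes R K ((cosyzygy R)^[n] N) := by
  have h := hK.finitelySplit_ker.extOneVanishes H inferInstance N
  rw [Submodule.span_eq] at h
  exact h.of_linearEquiv ((freeCover R K).quotKerEquivOfSurjective
    (Finsupp.linearCombination_id_surjective R K))

/-- If the injective dimensions of free modules are bounded by `n` and the `n`-th syzygy of a module
has a locally split presentation, then this syzygy is projective. -/
lemma projective_syzygy_of_locallySplitCover {n : ℕ}
    (H : ∀ (M : ModuleCat.{u} R) (X : Type u), ExtOneVanishes R ((syzygy R)^[n] M) (X →₀ R))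
    (M : ModuleCat.{u} R) (hM : LocallySplitCover R ((syzygy R)^[n] M)) :
    Module.Projective R ((syzygy R)^[n] M) := by
  have h1 : ∀ N : ModuleCat.{u} R, ExtOneVanishes R M ((cosyzygy R)^[n + n] N) := fun N => by
    rw [Function.iterate_add_apply, ← extOneVanishes_syzygy_iterate_iff]
    exact hM.extOneVanishes H N
  have h2 := extOneVanishes_cosyzygy_of_finite H (n + n) M h1
  refine Module.Projective.of_extOneVanishes fun N _ _ => ?_
  exact (extOneVanishes_syzygy_iterate_iff n M (ModuleCat.of R N)).2 (h2 (ModuleCat.of R N))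

lemma exists_injDimLE_of_silp_le {n : ℕ} (h : silp R ≤ n) (P : Type u) [AddCommGroup P]
    [Module R P] (hP : Module.Projective R P) : ∃ m ≤ n, InjDimLE R m P := by
  have h1 : injDim R P ≤ n := (le_iSup₂_of_le (ModuleCat.of R P) hP le_rfl).trans h
  have hne : {k : ℕ∞ | ∃ m : ℕ, k = (m : ℕ∞) ∧ InjDimLE R m P}.Nonempty := by
    rw [Set.nonempty_iff_ne_empty]
    intro he
    rw [injDim, he, sInf_empty] at h1
    exact absurd h1 (by simp)
  obtain ⟨m, hm, hP⟩ := csInf_mem hne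
  rw [injDim, hm] at h1
  exact ⟨m, by exact_mod_cast h1, hP⟩

end SpliLeSilp

/-- Let `R` be a ring which is a filtered colimit of a family of subrings
`R_λ`, each isomorphic to its opposite ring and left `ℵ₀`-noetherian, such that `R` is flat
as a right `R_λ`-module and `R_λ` is a direct summand of `R` as a left `R_λ`-module for each
`λ`. Then `l.spli(R) ≤ l.silp(R)`. -/
theorem spli_le_silp_of_filtered_colimit (R : Type u) [Ring R]
    (ι : Type u) [Nonempty ι] (S : ι → Subring R)
    (hdir : Directed (· ≤ ·) S)
    (hcover : ∀ x : R, ∃ i, x ∈ S i)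
    (hop : ∀ i, Nonempty (↥(S i) ≃+* (↥(S i))ᵐᵒᵖ))
    (hnoeth : ∀ i, IsLeftAleph0Noetherian ↥(S i))
    (hflat : ∀ i, RightFlatOverSubring R (S i))
    (hsummand : ∀ i, ∃ π : R →ₗ[↥(S i)] ↥(S i), ∀ a : ↥(S i), π ((a : R)) = a) :
    spli R ≤ silp R := by
  rcases eq_or_ne (silp R) ⊤ with htop | htop
  · exact htop ▸ le_top
  obtain ⟨n, hn⟩ := ENat.ne_top_iff_exists.1 htop
  have H (M : ModuleCat.{u} R) (X : Type u) :
      ExtOneVanishes R ((syzygy R)^[n] M) (X →₀ R) := by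
    obtain ⟨m, hmn, hm⟩ :=
      exists_injDimLE_of_silp_le hn.ge (X →₀ R) inferInstance
    obtain ⟨k, rfl⟩ := Nat.exists_eq_add_of_le hmn
    rw [Function.iterate_add_apply]
    exact hm.extOneVanishes m _ _
  obtain ⟨m, hmn, hm⟩ :=
    exists_injDimLE_of_silp_le hn.ge (ℕ →₀ R) inferInstance
  have hX (i : ι) (M : ModuleCat.{u} (S i)) (j : ℕ) (hj : n ≤ j) :
      ExtOneVanishes (S i) M ((cosyzygy (S i))^[j] (ModuleCat.of (S i) (ℕ →₀ S i))) :=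
    hm.extOneVanishes_cosyzygy_finsupp (hflat i) (hsummand i) m M j (hmn.trans hj)
  rw [← hn]
  refine iSup₂_le fun I hI => sInf_le ⟨n, rfl, ?_⟩
  refine projDimLE_of_projective_syzygy n I (projective_syzygy_of_locallySplitCover H I ?_)
  let j (i : ι) : ModuleCat.of (S i) I →ₛₗ[(S i).subtype] I :=
    { toFun := fun x => x
      map_add' := fun _ _ => rfl
      map_smul' := fun _ _ => rfl }
  have hj : IsFilteredUnion j :=
    ⟨fun _ _ _ h => h, fun _ x _ => ⟨x, rfl⟩, fun x => ⟨Classical.arbitrary ι, x, rfl⟩⟩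
  obtain ⟨j', hj'⟩ := hj.syzygy_iterate hdir hcover n
  refine hj'.locallySplitCover hdir hcover fun i => ?_
  exact .syzygy_of_injective (hnoeth i) (hop i).some n (hX i) _ ((hflat i).injective hI)
end

section
/- Let H be a Hopf algebra over a field k with bijective antipode and let K ⊆ H be a Hopf subalgebra with bijective antipode such that H is projective as a left K-module. Then Gpd_K(εk) ≤ Gpd_H(εk); equivalently, l.Ggldim(K) ≤ l.Ggldim(H). -/
open TensorProduct

universe u

section HopfSubalgebra

open CategoryTheory

section ShortExactPairs

variable {R : Type u} [Ring R]

/-- The linear maps `i` and `p` form a short exact sequence `0 → A → B → C → 0`. -/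
structure IsShortExactPair {A B C : Type u} [AddCommGroup A] [AddCommGroup B] [AddCommGroup C]
    [Module R A] [Module R B] [Module R C] (i : A →ₗ[R] B) (p : B →ₗ[R] C) : Prop where
  inj : Function.Injective i
  exact : Function.Exact i p
  surj : Function.Surjective p

variable {A B C D E P P' Y Y' : Type u} [AddCommGroup A] [AddCommGroup B] [AddCommGroup C]
  [AddCommGroup D] [AddCommGroup E] [AddCommGroup P] [AddCommGroup P'] [AddCommGroup Y]
  [AddCommGroup Y'] [Module R A] [Module R B] [Module R C] [Module R D] [Module R E] [Module R P]
  [Module R P'] [Module R Y] [Module R Y']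

namespace IsShortExactPair

lemma mkQ {i : A →ₗ[R] B} (hi : Function.Injective i) :
    IsShortExactPair i (LinearMap.range i).mkQ :=
  ⟨hi, LinearMap.exact_map_mkQ_range i, Submodule.mkQ_surjective _⟩

lemma ker {p : A →ₗ[R] B} (hp : Function.Surjective p) :
    IsShortExactPair (LinearMap.ker p).subtype p :=
  ⟨Subtype.val_injective, LinearMap.exact_subtype_ker_map p, hp⟩

lemma shortExact {i : A →ₗ[R] B} {p : B →ₗ[R] C} (h : IsShortExactPair i p) :
    (ModuleCat.shortComplexOfCompEqZero i p h.exact.linearMap_comp_eq_zero).ShortExact :=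
  ModuleCat.shortComplex_shortExact _ h.exact h.inj h.surj

/-- A linear map that kills the kernel of a surjection descends along it. -/
lemma exists_desc {i : A →ₗ[R] B} {p : B →ₗ[R] C} (h : IsShortExactPair i p) (f : B →ₗ[R] D)
    (hf : f ∘ₗ i = 0) : ∃ g : C →ₗ[R] D, g ∘ₗ p = f := by
  have hker : LinearMap.ker p ≤ LinearMap.ker f := by
    intro x hx
    obtain ⟨a, rfl⟩ := (h.exact x).mp hx
    exact LinearMap.congr_fun hf a
  refine ⟨(LinearMap.ker p).liftQ f hker ∘ₗ (p.quotKerEquivOfSurjective h.surj).symm, ?_⟩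
  ext x
  have : (p.quotKerEquivOfSurjective h.surj).symm (p x) = (LinearMap.ker p).mkQ x := by
    rw [LinearEquiv.symm_apply_eq]; rfl
  simp [this]

/-- The cokernels of compatible embeddings of the terms of a short exact sequence form a short
exact sequence. -/
lemma exists_coker {i : A →ₗ[R] E} {p : E →ₗ[R] B} (h : IsShortExactPair i p)
    {f : A →ₗ[R] P} {c : P →ₗ[R] Y} (hf : IsShortExactPair f c)
    {g : B →ₗ[R] P'} {c' : P' →ₗ[R] Y'} (hg : IsShortExactPair g c')
    {a : E →ₗ[R] P} (ha : a ∘ₗ i = f) :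
    Function.Injective (a.prod (g ∘ₗ p)) ∧
    ∃ (s : Y →ₗ[R] (P × P') ⧸ LinearMap.range (a.prod (g ∘ₗ p)))
      (t : ((P × P') ⧸ LinearMap.range (a.prod (g ∘ₗ p))) →ₗ[R] Y'), IsShortExactPair s t := by
  have hai : ∀ x, a (i x) = f x := fun x => LinearMap.congr_fun ha x
  have hpi : ∀ x, p (i x) = 0 := fun x => (h.exact _).mpr ⟨x, rfl⟩
  have hcg : ∀ x, c' (g x) = 0 := fun x => (hg.exact _).mpr ⟨x, rfl⟩
  set w := a.prod (g ∘ₗ p) with hw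
  have hwa : ∀ x, w x = (a x, g (p x)) := fun x => rfl
  refine ⟨?_, ?_⟩
  · rw [← LinearMap.ker_eq_bot, LinearMap.ker_eq_bot']
    intro x hx
    rw [hwa, Prod.mk_eq_zero] at hx
    have h2 : p x = 0 := hg.inj (by simpa using hx.2)
    obtain ⟨y, rfl⟩ := (h.exact x).mp h2
    have : y = 0 := hf.inj (by simpa [hai] using hx.1)
    simp [this]
  · obtain ⟨s, hs⟩ := hf.exists_desc ((LinearMap.range w).mkQ ∘ₗ LinearMap.inl R P P') (by
      ext x
      simp only [LinearMap.comp_apply, LinearMap.inl_apply, Submodule.mkQ_apply,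
        LinearMap.zero_apply, Submodule.Quotient.mk_eq_zero]
      exact ⟨i x, by simp [hwa, hai, hpi]⟩)
    have hs' : ∀ x, s (c x) = (LinearMap.range w).mkQ (x, 0) := fun x => LinearMap.congr_fun hs x
    let t := (LinearMap.range w).liftQ (c' ∘ₗ LinearMap.snd R P P') (by
      rintro _ ⟨x, rfl⟩
      simp [hwa, hcg])
    have ht : ∀ x y, t ((LinearMap.range w).mkQ (x, y)) = c' y := fun x y => rfl
    refine ⟨s, t, ?_, ?_, ?_⟩
    · rw [← LinearMap.ker_eq_bot, LinearMap.ker_eq_bot']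
      intro y hy
      obtain ⟨x, rfl⟩ := hf.surj y
      rw [hs', Submodule.mkQ_apply, Submodule.Quotient.mk_eq_zero] at hy
      obtain ⟨e, he⟩ := hy
      rw [hwa, Prod.mk_inj] at he
      have h2 : p e = 0 := hg.inj (by simpa using he.2)
      obtain ⟨z, rfl⟩ := (h.exact e).mp h2
      exact (hf.exact x).mpr ⟨z, by rw [← hai, he.1]⟩
    · intro q
      obtain ⟨⟨x, y⟩, rfl⟩ := Submodule.mkQ_surjective _ q
      constructor
      · intro hq
        rw [ht] at hq
        obtain ⟨b, rfl⟩ := (hg.exact y).mp hq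
        obtain ⟨e, rfl⟩ := h.surj b
        refine ⟨c (x - a e), ?_⟩
        rw [hs', ← sub_eq_zero, ← map_sub, Submodule.mkQ_apply, Submodule.Quotient.mk_eq_zero]
        exact ⟨-e, by simp [hwa]⟩
      · rintro ⟨z, hz⟩
        obtain ⟨x', rfl⟩ := hf.surj z
        rw [← hz, hs', ht, map_zero]
    · intro y
      obtain ⟨x, rfl⟩ := hg.surj y
      exact ⟨(LinearMap.range w).mkQ (0, x), ht _ _⟩

/-- The kernels of compatible surjections onto the terms of a short exact sequence form a short
exact sequence. -/
lemma exists_ker {i : A →ₗ[R] E} {p : E →ₗ[R] B} (h : IsShortExactPair i p)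
    {f : Y →ₗ[R] P} {c : P →ₗ[R] A} (hf : IsShortExactPair f c)
    {g : P' →ₗ[R] B} (hg : Function.Surjective g) {b : P' →ₗ[R] E} (hb : p ∘ₗ b = g) :
    Function.Surjective ((i ∘ₗ c).coprod b) ∧
    ∃ (s : Y →ₗ[R] LinearMap.ker ((i ∘ₗ c).coprod b))
      (t : LinearMap.ker ((i ∘ₗ c).coprod b) →ₗ[R] LinearMap.ker g), IsShortExactPair s t := by
  have hpb : ∀ x, p (b x) = g x := fun x => LinearMap.congr_fun hb x
  have hpi : ∀ x, p (i x) = 0 := fun x => (h.exact _).mpr ⟨x, rfl⟩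
  have hcf : ∀ x, c (f x) = 0 := fun x => (hf.exact _).mpr ⟨x, rfl⟩
  refine ⟨?_, ?_⟩
  · intro e
    obtain ⟨y, hy⟩ := hg (p e)
    obtain ⟨m, hm⟩ := (h.exact (e - b y)).mp (by rw [map_sub, hpb, hy, sub_self])
    obtain ⟨x, rfl⟩ := hf.surj m
    exact ⟨(x, y), by simp [hm]⟩
  · let s : Y →ₗ[R] LinearMap.ker ((i ∘ₗ c).coprod b) :=
      (LinearMap.inl R P P' ∘ₗ f).codRestrict _ (fun y => by simp [hcf])
    let t : LinearMap.ker ((i ∘ₗ c).coprod b) →ₗ[R] LinearMap.ker g :=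
      (LinearMap.snd R P P').restrict (fun x hx => by
        have := congrArg p (LinearMap.mem_ker.mp hx)
        simpa [hpi, hpb] using this)
    refine ⟨s, t, ?_, ?_, ?_⟩
    · intro x y hxy
      exact hf.inj (congrArg (fun z => z.1.1) hxy)
    · rintro ⟨⟨x, y⟩, hxy⟩
      constructor
      · intro h0
        have hy : y = 0 := congrArg Subtype.val h0
        subst hy
        have : i (c x) = 0 := by simpa using hxy
        obtain ⟨z, rfl⟩ := (hf.exact x).mp (h.inj (by simpa using this))
        exact ⟨z, rfl⟩
      · rintro ⟨z, hz⟩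
        rw [← hz]
        rfl
    · rintro ⟨y, hy⟩
      obtain ⟨m, hm⟩ := (h.exact (b y)).mp (by rw [hpb]; exact hy)
      obtain ⟨x, rfl⟩ := hf.surj m
      exact ⟨⟨(-x, y), by simp [hm]⟩, rfl⟩

/-- For embeddings `A → B → E`, the quotients `B / A`, `E / A`, `E / B` form a short exact
sequence. -/
lemma exists_comp {i : A →ₗ[R] B} {p : B →ₗ[R] C} (h : IsShortExactPair i p)
    {j : B →ₗ[R] E} {q : E →ₗ[R] D} (hj : IsShortExactPair j q) :
    ∃ (s : C →ₗ[R] E ⧸ LinearMap.range (j ∘ₗ i)) (t : (E ⧸ LinearMap.range (j ∘ₗ i)) →ₗ[R] D),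
      IsShortExactPair s t := by
  have hqj : ∀ x, q (j x) = 0 := fun x => (hj.exact _).mpr ⟨x, rfl⟩
  obtain ⟨s, hs⟩ := h.exists_desc ((LinearMap.range (j ∘ₗ i)).mkQ ∘ₗ j) (by
    ext x
    simp)
  have hs' : ∀ x, s (p x) = (LinearMap.range (j ∘ₗ i)).mkQ (j x) := fun x =>
    LinearMap.congr_fun hs x
  let t := (LinearMap.range (j ∘ₗ i)).liftQ q (by
    rintro _ ⟨x, rfl⟩
    simp [hqj])
  have ht : ∀ x, t ((LinearMap.range (j ∘ₗ i)).mkQ x) = q x := fun x => rfl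
  refine ⟨s, t, ?_, ?_, ?_⟩
  · rw [← LinearMap.ker_eq_bot, LinearMap.ker_eq_bot']
    intro y hy
    obtain ⟨x, rfl⟩ := h.surj y
    rw [hs', Submodule.mkQ_apply, Submodule.Quotient.mk_eq_zero] at hy
    obtain ⟨a, ha⟩ := hy
    exact (h.exact x).mpr ⟨a, hj.inj ha⟩
  · intro z
    obtain ⟨x, rfl⟩ := Submodule.mkQ_surjective _ z
    constructor
    · intro hx
      obtain ⟨b, rfl⟩ := (hj.exact x).mp hx
      exact ⟨p b, hs' b⟩
    · rintro ⟨y, hy⟩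
      obtain ⟨b, rfl⟩ := h.surj y
      rw [← hy, hs', ht, hqj]
  · intro y
    obtain ⟨x, rfl⟩ := hj.surj y
    exact ⟨(LinearMap.range (j ∘ₗ i)).mkQ x, ht x⟩

end IsShortExactPair

end ShortExactPairs

section Coresolutions

variable {R : Type u} [Ring R]

/-- `Y` is a first syzygy of `X` : there is a short exact sequence `0 → Y → P → X → 0` with `P`
projective. -/
def IsSyzygyStep (X Y : ModuleCat.{u} R) : Prop :=
  ∃ (P : ModuleCat.{u} R) (i : Y →ₗ[R] P) (p : P →ₗ[R] X),
    Module.Projective R P ∧ IsShortExactPair i p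

/-- `Ext¹(X, Q)` vanishes for all projective modules `Q`. -/
def ExtOneProjVanish (X : ModuleCat.{u} R) : Prop :=
  ∀ Q : ModuleCat.{u} R, Module.Projective R Q → Subsingleton (Abelian.Ext X Q 1)

namespace IsShortExactPair

section

variable {A B C : Type u} [AddCommGroup A] [AddCommGroup B] [AddCommGroup C]
  [Module R A] [Module R B] [Module R C] {i : A →ₗ[R] B} {p : B →ₗ[R] C}

lemma exists_extend (h : IsShortExactPair i p) (hC : ExtOneProjVanish (ModuleCat.of R C))
    {Q : Type u} [AddCommGroup Q] [Module R Q] [Module.Projective R Q] (f : A →ₗ[R] Q) :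
    ∃ g : B →ₗ[R] Q, g ∘ₗ i = f := by
  have := hC (ModuleCat.of R Q) ‹_›
  obtain ⟨x, hx⟩ := Abelian.Ext.contravariant_sequence_exact₁ h.shortExact (ModuleCat.of R Q)
    (Abelian.Ext.mk₀ (ModuleCat.ofHom f)) (add_zero 1) (Subsingleton.elim _ _)
  obtain ⟨g, rfl⟩ := Abelian.Ext.addEquiv₀.symm.surjective x
  refine ⟨g.hom, ?_⟩
  have h2 : ModuleCat.ofHom i ≫ g = ModuleCat.ofHom f := by
    apply Abelian.Ext.addEquiv₀.symm.injective
    simpa using hx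
  exact congrArg ModuleCat.Hom.hom h2

lemma extOneProjVanish_of_extend (h : IsShortExactPair i p) [Module.Projective R B]
    (hext : ∀ Q : ModuleCat.{u} R, Module.Projective R Q →
      ∀ f : A →ₗ[R] Q, ∃ g : B →ₗ[R] Q, g ∘ₗ i = f) :
    ExtOneProjVanish (ModuleCat.of R C) := by
  intro Q hQ
  refine subsingleton_of_forall_eq 0 fun x => ?_
  have := Abelian.Ext.subsingleton_of_projective (ModuleCat.of R B) Q 0
  obtain ⟨y, rfl⟩ := Abelian.Ext.contravariant_sequence_exact₃ h.shortExact Q x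
    (this.elim _ _) (add_zero 1)
  obtain ⟨f, rfl⟩ := Abelian.Ext.addEquiv₀.symm.surjective y
  obtain ⟨g, hg⟩ := hext Q hQ f.hom
  have hf : f = ModuleCat.ofHom i ≫ ModuleCat.ofHom g := by
    ext x
    exact (LinearMap.congr_fun hg x).symm
  have hz : h.shortExact.extClass.comp (Abelian.Ext.mk₀ (ModuleCat.ofHom i)) (add_zero 1) = 0 :=
    h.shortExact.extClass_comp
  subst hf
  change h.shortExact.extClass.comp (Abelian.Ext.mk₀ _) _ = 0
  rw [← Abelian.Ext.mk₀_comp_mk₀]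
  have := h.shortExact.extClass_comp_assoc (Abelian.Ext.mk₀ (ModuleCat.ofHom g)) (h := add_zero 1)
  exact this

lemma extOneProjVanish (h : IsShortExactPair i p) (hA : ExtOneProjVanish (ModuleCat.of R A))
    (hC : ExtOneProjVanish (ModuleCat.of R C)) : ExtOneProjVanish (ModuleCat.of R B) := by
  intro Q hQ
  have := hA Q hQ
  have := hC Q hQ
  refine subsingleton_of_forall_eq 0 fun x => ?_
  obtain ⟨y, rfl⟩ := Abelian.Ext.contravariant_sequence_exact₂ h.shortExact Q x
    (Subsingleton.elim _ _)
  rw [Subsingleton.elim y 0, Abelian.Ext.comp_zero]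

end

end IsShortExactPair

/-- `X` has a coresolution `0 → X → P₀ → P₁ → ⋯` by projective modules, all of whose cosyzygies
(including `X`) satisfy `C`. -/
def HasProjCoresolution (C : ModuleCat.{u} R → Prop) (X : ModuleCat.{u} R) : Prop :=
  ∃ 𝒞 : ModuleCat.{u} R → Prop, 𝒞 X ∧ ∀ Y, 𝒞 Y → C Y ∧ ∃ Z, 𝒞 Z ∧ IsSyzygyStep Z Y

namespace HasProjCoresolution

variable {C : ModuleCat.{u} R → Prop} {X : ModuleCat.{u} R}

lemma prop (h : HasProjCoresolution C X) : C X := by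
  obtain ⟨𝒞, hX, h𝒞⟩ := h
  exact (h𝒞 X hX).1

lemma exists_step (h : HasProjCoresolution C X) :
    ∃ Z, HasProjCoresolution C Z ∧ IsSyzygyStep Z X := by
  obtain ⟨𝒞, hX, h𝒞⟩ := h
  obtain ⟨Z, hZ, hs⟩ := (h𝒞 X hX).2
  exact ⟨Z, ⟨𝒞, hZ, h𝒞⟩, hs⟩

lemma extension {A B D : ModuleCat.{u} R} {i : A →ₗ[R] B} {p : B →ₗ[R] D}
    (h : IsShortExactPair i p) (hA : HasProjCoresolution ExtOneProjVanish A)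
    (hD : HasProjCoresolution ExtOneProjVanish D) :
    HasProjCoresolution ExtOneProjVanish B := by
  refine ⟨fun B => ∃ (A D : ModuleCat.{u} R) (i : A →ₗ[R] B) (p : B →ₗ[R] D),
    IsShortExactPair i p ∧ HasProjCoresolution ExtOneProjVanish A ∧
    HasProjCoresolution ExtOneProjVanish D, ⟨A, D, i, p, h, hA, hD⟩, ?_⟩
  clear h hA hD i p A B D
  rintro B ⟨A, D, i, p, h, hA, hD⟩
  refine ⟨h.extOneProjVanish hA.prop hD.prop, ?_⟩
  obtain ⟨A', hA', P, f, c, hP, hf⟩ := hA.exists_step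
  obtain ⟨D', hD', P', g, c', hP', hg⟩ := hD.exists_step
  obtain ⟨a, ha⟩ := h.exists_extend hD.prop f
  obtain ⟨hinj, s, t, hst⟩ := h.exists_coker hf hg ha
  exact ⟨ModuleCat.of R (_ ⧸ _), ⟨A', D', s, t, hst, hA', hD'⟩, ModuleCat.of R (P × P'), _, _,
    inferInstanceAs (Module.Projective R (P × P')), IsShortExactPair.mkQ hinj⟩

end HasProjCoresolution

lemma IsGorensteinProjective.hasProjCoresolution {X : ModuleCat.{u} R}
    (h : IsGorensteinProjective R X) : HasProjCoresolution ExtOneProjVanish X := by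
  obtain ⟨P, d, hP, hd, hQ, ⟨e⟩⟩ := h
  refine ⟨fun Y => ∃ j, Nonempty (Y ≃ₗ[R] LinearMap.ker (d j)), ⟨0, ⟨e⟩⟩, ?_⟩
  rintro Y ⟨j, ⟨e⟩⟩
  have hdd : ∀ j x, d j (d (j + 1) x) = 0 := fun j x => by
    have : d (j + 1) x ∈ LinearMap.ker (d j) := hd j ▸ LinearMap.mem_range_self _ x
    exact this
  have hmem : ∀ j x, d j x = 0 → ∃ y, d (j + 1) y = x := fun j x hx => by
    have : x ∈ LinearMap.range (d (j + 1)) := (hd j).symm ▸ hx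
    exact this
  constructor
  · let π : P (j + 1 + 1) →ₗ[R] Y :=
      e.symm.toLinearMap ∘ₗ (d (j + 1)).codRestrict (LinearMap.ker (d j)) (hdd j)
    have hπ : ∀ x, (e (π x) : P (j + 1)) = d (j + 1) x := fun x =>
      congrArg Subtype.val (e.apply_symm_apply _)
    have hs : Function.Surjective π := by
      intro y
      obtain ⟨x, hx⟩ := hmem j (e y) (e y).2
      exact ⟨x, e.injective (Subtype.ext (by rw [hπ, hx]))⟩
    have hker : ∀ x, π x = 0 ↔ d (j + 1) x = 0 := fun x => by
      rw [← hπ]; simp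
    refine (IsShortExactPair.ker hs).extOneProjVanish_of_extend ?_
    intro Q hQp f
    obtain ⟨g, hg⟩ := hQ Q hQp (j + 1 + 1)
      (f ∘ₗ (d (j + 1 + 1)).codRestrict (LinearMap.ker π) (fun x => by
        rw [LinearMap.mem_ker, hker, hdd])) (by
        ext x
        have : (d (j + 1 + 1)).codRestrict (LinearMap.ker π) (fun x => by
          rw [LinearMap.mem_ker, hker, hdd]) (d (j + 1 + 1 + 1) x) = 0 :=
            Subtype.ext (hdd _ _)
        simp [this])
    refine ⟨g, ?_⟩
    ext ⟨x, hx⟩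
    obtain ⟨y, rfl⟩ := hmem (j + 1) x ((hker x).mp hx)
    exact LinearMap.congr_fun hg y
  · obtain ⟨j, rfl⟩ : ∃ j', j = j' + 1 := ⟨j - 1, by ring⟩
    refine ⟨ModuleCat.of R (LinearMap.ker (d j)), ⟨j, ⟨LinearEquiv.refl _ _⟩⟩,
      P (j + 1 + 1), (LinearMap.ker (d (j + 1))).subtype ∘ₗ e.toLinearMap,
      (d (j + 1)).codRestrict (LinearMap.ker (d j)) (hdd j), hP _, ?_, ?_, ?_⟩
    · exact Subtype.val_injective.comp e.injective
    · intro x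
      constructor
      · intro hx
        have hx' : d (j + 1) x = 0 := congrArg Subtype.val hx
        exact ⟨e.symm ⟨x, hx'⟩, by simp⟩
      · rintro ⟨y, rfl⟩
        exact Subtype.ext (e y).2
    · rintro ⟨y, hy⟩
      obtain ⟨x, hx⟩ := hmem j y hy
      exact ⟨x, Subtype.ext hx⟩

/-- A module of Gorenstein projective dimension at most `n` embeds into a module of projective
dimension at most `n`, with cokernel admitting a suitable projective coresolution. -/
lemma GProjDimLE.exists_embedding (n : ℕ) (M : ModuleCat.{u} R) (h : GProjDimLE R n M) :
    ∃ (L C : ModuleCat.{u} R) (i : M →ₗ[R] L) (p : L →ₗ[R] C), IsShortExactPair i p ∧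
      HasProjectiveDimensionLT L (n + 1) ∧ HasProjCoresolution ExtOneProjVanish C := by
  have key : ∀ (n : ℕ) (M : ModuleCat.{u} R), IsGorensteinProjective R M →
      ∃ (L C : ModuleCat.{u} R) (i : M →ₗ[R] L) (p : L →ₗ[R] C), IsShortExactPair i p ∧
      HasProjectiveDimensionLT L (n + 1) ∧ HasProjCoresolution ExtOneProjVanish C := by
    intro n M hM
    obtain ⟨Z, hZ, P, i, p, hP, hip⟩ := hM.hasProjCoresolution.exists_step
    exact ⟨P, Z, i, p, hip, hasProjectiveDimensionLT_of_ge P 1 (n + 1) (by omega), hZ⟩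
  induction n generalizing M with
  | zero => exact key 0 M h
  | succ n ih =>
    obtain hG | ⟨G, f, hG, hf, hK⟩ := h
    · exact key _ M hG
    · obtain ⟨L', C', j, c, hjc, hL', hC'⟩ := ih (ModuleCat.of R (LinearMap.ker f)) hK
      obtain ⟨G', hG', P, i, p, hP, hip⟩ := hG.hasProjCoresolution.exists_step
      obtain ⟨D, hD, P', i', p', hP', hip'⟩ := hC'.exists_step
      have hinj : Function.Injective (i ∘ₗ (LinearMap.ker f).subtype) :=
        hip.inj.comp Subtype.val_injective
      obtain ⟨a, ha⟩ := hjc.exists_extend hC'.prop (i ∘ₗ (LinearMap.ker f).subtype)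
      obtain ⟨s, t, hst⟩ := (IsShortExactPair.ker hf).exists_comp hip
      obtain ⟨winj, s', t', hst'⟩ := hjc.exists_coker (IsShortExactPair.mkQ hinj) hip' ha
      obtain ⟨s₂, t₂, hst₂⟩ := hst.exists_comp hst'
      refine ⟨ModuleCat.of R (_ ⧸ _), ModuleCat.of R (_ ⧸ _), s' ∘ₗ s, _,
        IsShortExactPair.mkQ (hst'.inj.comp hst.inj), ?_, ?_⟩
      · exact (IsShortExactPair.mkQ winj).shortExact.hasProjectiveDimensionLT_X₃ (n + 1) hL'
          (hasProjectiveDimensionLT_of_ge (ModuleCat.of R (P × P')) 1 (n + 1 + 1) (by omega))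
      · exact HasProjCoresolution.extension (B := ModuleCat.of R (_ ⧸ _)) hst₂ hG' hD

end Coresolutions

section GorensteinGlobalDimension

variable {R : Type u} [Ring R]

lemma exists_isSyzygyStep (X : ModuleCat.{u} R) : ∃ Y, IsSyzygyStep X Y :=
  ⟨ModuleCat.of R (LinearMap.ker (Finsupp.linearCombination R (id : X → X))),
    ModuleCat.of R (X →₀ R), _, _, inferInstanceAs (Module.Projective R (X →₀ R)),
    IsShortExactPair.ker (Finsupp.linearCombination_id_surjective R X)⟩

lemma HasProjCoresolution.exists_int_sequence {C : ModuleCat.{u} R → Prop} {X : ModuleCat.{u} R}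
    (h : HasProjCoresolution C X) :
    ∃ z : ℤ → ModuleCat.{u} R, z 2 = X ∧ ∀ i, IsSyzygyStep (z i) (z (i + 1)) := by
  choose s hs using fun X : ModuleCat.{u} R => exists_isSyzygyStep X
  choose t ht using fun X : {X : ModuleCat.{u} R // HasProjCoresolution C X} => X.2.exists_step
  let t' : {X : ModuleCat.{u} R // HasProjCoresolution C X} →
    {X : ModuleCat.{u} R // HasProjCoresolution C X} := fun X => ⟨t X, (ht X).1⟩
  refine ⟨fun i => if 2 ≤ i then s^[(i - 2).toNat] X else (t'^[(2 - i).toNat] ⟨X, h⟩).1,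
    by simp, fun i => ?_⟩
  by_cases hi : 2 ≤ i
  · have h1 : (i + 1 - 2).toNat = (i - 2).toNat + 1 := by omega
    have h2 : 2 ≤ i + 1 := by omega
    simp only [if_pos hi, if_pos h2, h1, Function.iterate_succ_apply']
    exact hs _
  · have h3 : (if 2 ≤ i + 1 then s^[(i + 1 - 2).toNat] X
        else (t'^[(2 - (i + 1)).toNat] ⟨X, h⟩).1) = (t'^[(2 - (i + 1)).toNat] ⟨X, h⟩).1 := by
      split_ifs with h2
      · obtain rfl : i = 1 := by omega
        simp
      · rfl
    have h1 : (2 - i).toNat = (2 - (i + 1)).toNat + 1 := by omega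
    simp only [if_neg hi, h3, h1, Function.iterate_succ_apply']
    exact (ht _).2

/-- `Z` is an `n`-th syzygy of `X`. -/
def IsSyzygy : ℕ → ModuleCat.{u} R → ModuleCat.{u} R → Prop
  | 0, X, Z => X = Z
  | n + 1, X, Z => ∃ Y, IsSyzygyStep X Y ∧ IsSyzygy n Y Z

lemma IsSyzygy.horseshoe (n : ℕ) {A B C Z : ModuleCat.{u} R} {i : A →ₗ[R] B} {p : B →ₗ[R] C}
    (h : IsShortExactPair i p) (hZ : IsSyzygy n A Z) :
    ∃ (Q Z' : ModuleCat.{u} R) (s : Z →ₗ[R] Q) (t : Q →ₗ[R] Z'), IsSyzygy n B Q ∧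
      IsSyzygy n C Z' ∧ IsShortExactPair s t := by
  induction n generalizing A B C with
  | zero =>
    obtain rfl : A = Z := hZ
    exact ⟨B, C, i, p, rfl, rfl, h⟩
  | succ n ih =>
    obtain ⟨Y, ⟨P, f, c, hP, hf⟩, hYZ⟩ := hZ
    obtain ⟨K, P', k, g, hP', hk⟩ := exists_isSyzygyStep C
    obtain ⟨b, hb⟩ := Module.projective_lifting_property p g h.surj
    obtain ⟨hs, s, t, hst⟩ := h.exists_ker hf hk.surj hb
    obtain ⟨Q, Z', s', t', hQ, hZ', hst'⟩ :=
      ih (B := ModuleCat.of R (LinearMap.ker _)) (C := ModuleCat.of R (LinearMap.ker _)) hst hYZ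
    exact ⟨Q, Z', s', t', ⟨_, ⟨ModuleCat.of R (P × P'), _, _,
      inferInstanceAs (Module.Projective R (P × P')), IsShortExactPair.ker hs⟩, hQ⟩,
      ⟨_, ⟨P', _, _, hP', IsShortExactPair.ker hk.surj⟩, hZ'⟩, hst'⟩

lemma IsSyzygy.projective (n : ℕ) {X Z : ModuleCat.{u} R} (h : IsSyzygy n X Z)
    (hX : HasProjectiveDimensionLT X (n + 1)) : Module.Projective R Z := by
  induction n generalizing X with
  | zero =>
    obtain rfl : X = Z := h
    rw [zero_add] at hX
    have : Projective X := (projective_iff_hasProjectiveDimensionLT_one).mpr hX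
    infer_instance
  | succ n ih =>
    obtain ⟨Y, ⟨P, f, c, hP, hf⟩, hYZ⟩ := h
    exact ih hYZ (hf.shortExact.hasProjectiveDimensionLT_X₁ (n + 1)
      (hasProjectiveDimensionLT_of_ge P 1 (n + 1) (by omega)) hX)

/-- An exact endofunctor of the category of `R`-modules whose values have projective dimension at
most `n`, with a natural embedding of the identity functor that splits on projective modules. -/
structure FiniteProjDimEmbedding (R : Type u) [Ring R] (n : ℕ) where
  /-- The underlying functor. -/
  T : ModuleCat.{u} R ⥤ ModuleCat.{u} R
  /-- The natural transformation from the identity functor. -/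
  η : 𝟭 _ ⟶ T
  exact : ∀ {A B C : ModuleCat.{u} R} (i : A ⟶ B) (p : B ⟶ C),
    IsShortExactPair i.hom p.hom → IsShortExactPair (T.map i).hom (T.map p).hom
  injective : ∀ X, Function.Injective (η.app X)
  projective : ∀ Q : ModuleCat.{u} R, Module.Projective R Q → Module.Projective R (T.obj Q)
  retraction : ∀ Q : ModuleCat.{u} R, Module.Projective R Q → ∃ r : T.obj Q ⟶ Q, η.app Q ≫ r = 𝟙 Q
  projDim : ∀ X, HasProjectiveDimensionLT (T.obj X) (n + 1)

namespace FiniteProjDimEmbedding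

variable {n : ℕ}

lemma hasProjCoresolution_of_isSyzygy (F : FiniteProjDimEmbedding R n)
    {X Z : ModuleCat.{u} R} (h : IsSyzygy n X Z) :
    HasProjCoresolution (fun _ => True) Z := by
  refine ⟨fun Z => ∃ X, IsSyzygy n X Z, ⟨X, h⟩, ?_⟩
  rintro Z ⟨X, h⟩
  refine ⟨trivial, ?_⟩
  obtain ⟨Q, Z', s, t, hQ, hZ', hst⟩ :=
    h.horseshoe (B := F.T.obj X) (C := ModuleCat.of R (_ ⧸ _)) n
      (IsShortExactPair.mkQ (F.injective X))
  exact ⟨Z', ⟨_, hZ'⟩, Q, s, t, hQ.projective n (F.projDim X), hst⟩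

lemma projective_obj_of_int_sequence (F : FiniteProjDimEmbedding R n) {z : ℤ → ModuleCat.{u} R}
    (hz : ∀ i, IsSyzygyStep (z i) (z (i + 1))) (i : ℤ) : Module.Projective R (F.T.obj (z i)) := by
  suffices ∀ m ≤ n, ∀ i, HasProjectiveDimensionLT (F.T.obj (z i)) (n - m + 1) by
    have h := this n le_rfl i
    rw [Nat.sub_self, zero_add] at h
    have : Projective (F.T.obj (z i)) := inferInstance
    infer_instance
  intro m
  induction m with
  | zero => exact fun _ i => F.projDim _
  | succ m ih =>
    intro hm i
    obtain ⟨j, rfl⟩ : ∃ j, i = j + 1 := ⟨i - 1, by ring⟩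
    obtain ⟨P, ι, π, hP, h⟩ := hz j
    have hTP := F.projective P hP
    refine (F.exact (ModuleCat.ofHom ι) (ModuleCat.ofHom π) h).shortExact.hasProjectiveDimensionLT_X₁
      _ (hasProjectiveDimensionLT_of_ge (F.T.obj P) 1 _ (by omega)) ?_
    have := ih (by omega) j
    rwa [show n - m = n - (m + 1) + 1 by omega] at this

lemma exists_extend (F : FiniteProjDimEmbedding R n)
    {A B C : ModuleCat.{u} R} {i : A →ₗ[R] B} {p : B →ₗ[R] C}
    (h : IsShortExactPair i p) (hC : Module.Projective R (F.T.obj C))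
    (Q : ModuleCat.{u} R) (hQ : Module.Projective R Q) (f : A →ₗ[R] Q) :
    ∃ g : B →ₗ[R] Q, g ∘ₗ i = f := by
  have hT := F.exact (ModuleCat.ofHom i) (ModuleCat.ofHom p) h
  have hTQ := F.projective Q hQ
  have hv : ExtOneProjVanish (ModuleCat.of R (F.T.obj C)) := fun Q _ =>
    Abelian.Ext.subsingleton_of_projective (ModuleCat.of R (F.T.obj C)) Q 0
  obtain ⟨g, hg⟩ := hT.exists_extend hv (F.T.map (ModuleCat.ofHom f)).hom
  obtain ⟨r, hr⟩ := F.retraction Q hQ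
  refine ⟨(F.η.app B ≫ ModuleCat.ofHom g ≫ r).hom, ?_⟩
  have hg' : F.T.map (ModuleCat.ofHom i) ≫ ModuleCat.ofHom g = F.T.map (ModuleCat.ofHom f) :=
    ModuleCat.hom_ext hg
  have h1 := F.η.naturality (ModuleCat.ofHom i)
  have h2 := F.η.naturality (ModuleCat.ofHom f)
  have : ModuleCat.ofHom i ≫ F.η.app B ≫ ModuleCat.ofHom g ≫ r = ModuleCat.ofHom f := by
    simp only [Functor.id_map] at h1 h2
    rw [← Category.assoc, h1, Category.assoc, ← Category.assoc (F.T.map _), hg', ← Category.assoc,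
      ← h2, Category.assoc, hr]
    exact Category.comp_id (ModuleCat.ofHom f)
  exact congrArg ModuleCat.Hom.hom this

lemma isGorensteinProjective_of_hasProjCoresolution (F : FiniteProjDimEmbedding R n)
    {X : ModuleCat.{u} R}
    (h : HasProjCoresolution (fun _ => True) X) : IsGorensteinProjective R X := by
  obtain ⟨z, rfl, hz⟩ := h.exists_int_sequence
  have hpr := F.projective_obj_of_int_sequence hz
  choose P ι π hP h using hz
  refine ⟨P, fun i => ι i ∘ₗ π (i + 1), hP, ?_, ?_, ⟨?_⟩⟩
  · intro i
    rw [LinearMap.range_comp, LinearMap.range_eq_top.mpr (h _).surj, Submodule.map_top,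
      LinearMap.ker_comp, LinearMap.ker_eq_bot.mpr (h i).inj, Submodule.comap_bot]
    exact (h (i + 1)).exact.linearMap_ker_eq.symm
  · intro Q hQ i f hf
    obtain ⟨f', rfl⟩ := (h (i + 1)).exists_desc f (by
      ext x
      obtain ⟨y, rfl⟩ := (h (i + 1 + 1)).surj x
      exact LinearMap.congr_fun hf y)
    obtain ⟨g, hg⟩ := F.exists_extend (h i) (hpr i) Q hQ f'
    exact ⟨g, by rw [← hg, LinearMap.comp_assoc]⟩
  · have hk : LinearMap.range (ι (0 + 1)) = LinearMap.ker (ι 0 ∘ₗ π (0 + 1)) := by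
      rw [LinearMap.ker_comp, LinearMap.ker_eq_bot.mpr (h 0).inj, Submodule.comap_bot]
      exact (h (0 + 1)).exact.linearMap_ker_eq.symm
    exact (LinearEquiv.ofInjective _ (h (0 + 1)).inj).trans (LinearEquiv.ofEq _ _ hk)

lemma isGorensteinProjective_of_projective (F : FiniteProjDimEmbedding R n)
    (P : ModuleCat.{u} R) (hP : Module.Projective R P) :
    IsGorensteinProjective R P := by
  refine F.isGorensteinProjective_of_hasProjCoresolution
    ⟨fun P => Module.Projective R P, hP, fun P hP => ⟨trivial, ModuleCat.of R PUnit.{u + 1},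
      inferInstanceAs (Module.Projective R PUnit.{u + 1}), P, LinearMap.id, 0, hP, ?_⟩⟩
  exact ⟨Function.injective_id, fun x => by simp, fun x => ⟨0, rfl⟩⟩

/-- All modules have Gorenstein projective dimension at most `n`. -/
theorem gProjDimLE (F : FiniteProjDimEmbedding R n) (M : ModuleCat.{u} R) : GProjDimLE R n M := by
  suffices ∀ (m : ℕ) (M : ModuleCat.{u} R),
      (∀ Z, IsSyzygy m M Z → IsGorensteinProjective R Z) → GProjDimLE R m M from
    this n M fun Z hZ =>
      F.isGorensteinProjective_of_hasProjCoresolution (F.hasProjCoresolution_of_isSyzygy hZ)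
  intro m
  induction m with
  | zero => exact fun M h => h M rfl
  | succ m ih =>
    intro M h
    obtain ⟨K, P, i, p, hP, hip⟩ := exists_isSyzygyStep M
    refine Or.inr ⟨P, p, F.isGorensteinProjective_of_projective P hP, hip.surj,
      ih (ModuleCat.of R (LinearMap.ker p)) fun Z hZ => h Z ⟨_, ?_, hZ⟩⟩
    exact ⟨P, _, p, hP, IsShortExactPair.ker hip.surj⟩

end FiniteProjDimEmbedding

end GorensteinGlobalDimension

section ProjectiveDimension

variable {R S : Type u} [Ring R] [Ring S]

lemma hasProjectiveDimensionLT_obj (T : ModuleCat.{u} R ⥤ ModuleCat.{u} S)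
    (hT : ∀ {A B C : ModuleCat.{u} R} (i : A ⟶ B) (p : B ⟶ C),
      IsShortExactPair i.hom p.hom → IsShortExactPair (T.map i).hom (T.map p).hom)
    (hP : ∀ P : ModuleCat.{u} R, Module.Projective R P → Module.Projective S (T.obj P))
    (n : ℕ) (X : ModuleCat.{u} R) (hX : HasProjectiveDimensionLT X (n + 1)) :
    HasProjectiveDimensionLT (T.obj X) (n + 1) := by
  induction n generalizing X with
  | zero =>
    rw [zero_add] at hX ⊢
    have : Projective X := projective_iff_hasProjectiveDimensionLT_one.mpr hX
    have := hP X inferInstance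
    exact projective_iff_hasProjectiveDimensionLT_one.mp inferInstance
  | succ n ih =>
    obtain ⟨Y, P, i, p, hPP, h⟩ := exists_isSyzygyStep X
    have hTP := hP P hPP
    refine (hT (ModuleCat.ofHom i) (ModuleCat.ofHom p) h).shortExact.hasProjectiveDimensionLT_X₃ _
      (ih Y ?_) (hasProjectiveDimensionLT_of_ge (T.obj P) 1 _ (by omega))
    exact h.shortExact.hasProjectiveDimensionLT_X₁ (n + 1)
      (hasProjectiveDimensionLT_of_ge P 1 (n + 1) (by omega)) hX

lemma projective_restrictScalars (φ : R →+* S)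
    (hφ : @Module.Projective R _ S _ (Module.compHom S φ)) (P : ModuleCat.{u} S)
    (hP : Module.Projective S P) :
    Module.Projective R ((ModuleCat.restrictScalars φ).obj P) := by
  let : Module R S := Module.compHom S φ
  obtain ⟨s, hs⟩ := hP
  have : Module.Projective R (P →₀ S) :=
    haveI := Classical.decEq P
    haveI : DecidableEq S := Classical.decEq S
    Module.Projective.of_equiv (finsuppLequivDFinsupp (ι := P) (M := S) R).symm
  let s' : (ModuleCat.restrictScalars φ).obj P →ₗ[R] (P →₀ S) :=
    { toFun := s
      map_add' := fun x y => s.map_add x y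
      map_smul' := fun r x => s.map_smul (φ r) x }
  let p' : (P →₀ S) →ₗ[R] (ModuleCat.restrictScalars φ).obj P :=
    { toFun := Finsupp.linearCombination S id
      map_add' := fun x y => map_add _ x y
      map_smul' := fun r x => (Finsupp.linearCombination S (id : P → P)).map_smul (φ r) x }
  exact Module.Projective.of_split s' p' (LinearMap.ext hs)

end ProjectiveDimension

section Convolution

variable {k K : Type u} [CommRing k] [Ring K] [Algebra k K]
  {N : Type u} [AddCommGroup N] [Module k N] [Module K N] [IsScalarTower k K N]

/-- For a comultiplication `δ` and a linear endomorphism `s` of `K`, the map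
`h ⊗ n ↦ ∑ h₁ ⊗ s h₂ • n`. -/
def twist (δ : K →ₗ[k] K ⊗[k] K) (s : K →ₗ[k] K) : K ⊗[k] N →ₗ[k] K ⊗[k] N :=
  (TensorProduct.lift ((Algebra.lsmul k k N).toLinearMap ∘ₗ s)).lTensor K ∘ₗ
    (TensorProduct.assoc k K K N).toLinearMap ∘ₗ δ.rTensor N

/-- The orbit map `h ↦ h • n`. -/
def orbitMap (n : N) : K →ₗ[k] N := (Algebra.lsmul k k N).toLinearMap.flip n

lemma orbitMap_apply (n : N) (h : K) : orbitMap (k := k) n h = h • n := rfl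

lemma twist_tmul (δ : K →ₗ[k] K ⊗[k] K) (s : K →ₗ[k] K) (h : K) (n : N) :
    twist δ s (h ⊗ₜ[k] n) = (orbitMap n ∘ₗ s).lTensor K (δ h) := by
  simp only [twist, LinearMap.comp_apply, LinearMap.rTensor_tmul, LinearEquiv.coe_coe]
  induction δ h with
  | zero => simp
  | add x y hx hy => simp only [TensorProduct.add_tmul, map_add, hx, hy]
  | tmul a b => simp [orbitMap_apply]

lemma twist_twist (δ : K →ₗ[k] K ⊗[k] K)
    (hδ : ∀ h, TensorProduct.assoc k K K K (δ.rTensor K (δ h)) = δ.lTensor K (δ h))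
    (s t : K →ₗ[k] K) (x : K ⊗[k] N) :
    twist δ s (twist δ t x) = twist δ (LinearMap.mul' k K ∘ₗ TensorProduct.map s t ∘ₗ δ) x := by
  induction x with
  | zero => simp
  | add x y hx hy => simp only [map_add, hx, hy]
  | tmul h n =>
    have key : ∀ z : K ⊗[k] K, twist δ s ((orbitMap n ∘ₗ t).lTensor K z) =
        (orbitMap n ∘ₗ LinearMap.mul' k K ∘ₗ TensorProduct.map s t).lTensor K
          (TensorProduct.assoc k K K K (δ.rTensor K z)) := by
      intro z
      induction z with
      | zero => simp
      | add x y hx hy => simp only [map_add, hx, hy]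
      | tmul a b =>
        simp only [LinearMap.lTensor_tmul, LinearMap.rTensor_tmul, twist_tmul]
        induction δ a with
        | zero => simp
        | add x y hx hy => simp only [TensorProduct.add_tmul, map_add, hx, hy]
        | tmul c d => simp [orbitMap_apply, mul_smul]
    rw [twist_tmul, key, hδ, twist_tmul, ← LinearMap.comp_apply, ← LinearMap.lTensor_comp]
    rfl

lemma twist_bijective (δ : K →ₗ[k] K ⊗[k] K)
    (hδ : ∀ h, TensorProduct.assoc k K K K (δ.rTensor K (δ h)) = δ.lTensor K (δ h))
    (e : K →ₗ[k] k) (he : ∀ h, e.lTensor K (δ h) = h ⊗ₜ 1) (s : K →ₗ[k] K)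
    (hs : LinearMap.mul' k K ∘ₗ s.rTensor K ∘ₗ δ = Algebra.linearMap k K ∘ₗ e)
    (hs' : LinearMap.mul' k K ∘ₗ s.lTensor K ∘ₗ δ = Algebra.linearMap k K ∘ₗ e) :
    Function.Bijective (twist δ LinearMap.id : K ⊗[k] N →ₗ[k] K ⊗[k] N) := by
  have h1 : ∀ x : K ⊗[k] N, twist δ (Algebra.linearMap k K ∘ₗ e) x = x := by
    intro x
    induction x with
    | zero => simp
    | add x y hx hy => simp only [map_add, hx, hy]
    | tmul h n =>
      rw [twist_tmul, ← LinearMap.comp_assoc, LinearMap.lTensor_comp, LinearMap.comp_apply, he]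
      simp [orbitMap_apply]
  refine Function.bijective_iff_has_inverse.mpr ⟨twist δ s, fun x => ?_, fun x => ?_⟩
  · rw [twist_twist δ hδ]
    exact (congrArg (fun t => twist δ t x) hs).trans (h1 x)
  · rw [twist_twist δ hδ]
    exact (congrArg (fun t => twist δ t x) hs').trans (h1 x)

end Convolution

section HopfTwist

variable {k K : Type u} [CommRing k] [Ring K] [HopfAlgebra k K]
  {N : Type u} [AddCommGroup N] [Module k N] [Module K N] [IsScalarTower k K N]

lemma twist_comul_bijective :
    Function.Bijective (twist Coalgebra.comul LinearMap.id : K ⊗[k] N →ₗ[k] K ⊗[k] N) :=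
  twist_bijective _ Coalgebra.coassoc_apply Coalgebra.counit Coalgebra.lTensor_counit_comul
    (HopfAlgebra.antipode k) HopfAlgebra.mul_antipode_rTensor_comul
    HopfAlgebra.mul_antipode_lTensor_comul

/-- The co-opposite comultiplication. -/
def comulCop (k K : Type u) [CommRing k] [Ring K] [HopfAlgebra k K] : K →ₗ[k] K ⊗[k] K :=
  (TensorProduct.comm k K K).toLinearMap ∘ₗ Coalgebra.comul

lemma comulCop_apply (h : K) :
    comulCop k K h = TensorProduct.comm k K K (Coalgebra.comul h) := rfl

lemma comulCop_coassoc (h : K) :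
    TensorProduct.assoc k K K K ((comulCop k K).rTensor K (comulCop k K h)) =
      (comulCop k K).lTensor K (comulCop k K h) := by
  let rev : K ⊗[k] (K ⊗[k] K) →ₗ[k] K ⊗[k] (K ⊗[k] K) :=
    (TensorProduct.assoc k K K K).toLinearMap ∘ₗ
      (TensorProduct.comm k K (K ⊗[k] K)).toLinearMap ∘ₗ
      (TensorProduct.comm k K K).toLinearMap.lTensor K
  have h1 : ∀ z : K ⊗[k] K, TensorProduct.assoc k K K K ((comulCop k K).rTensor K
      (TensorProduct.comm k K K z)) = rev (Coalgebra.comul.lTensor K z) := by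
    intro z
    induction z with
    | zero => simp
    | add x y hx hy => simp only [map_add, hx, hy]
    | tmul a b => simp [rev, comulCop_apply]
  have h2 : ∀ z : K ⊗[k] K, (comulCop k K).lTensor K (TensorProduct.comm k K K z) =
      rev (TensorProduct.assoc k K K K (Coalgebra.comul.rTensor K z)) := by
    intro z
    induction z with
    | zero => simp
    | add x y hx hy => simp only [map_add, hx, hy]
    | tmul a b =>
      simp only [TensorProduct.comm_tmul, LinearMap.lTensor_tmul, LinearMap.rTensor_tmul,
        comulCop_apply]
      induction (Coalgebra.comul (R := k) a) with
      | zero => simp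
      | add x y hx hy => simp only [TensorProduct.add_tmul, TensorProduct.tmul_add, map_add, hx, hy]
      | tmul c d => simp [rev]
  rw [comulCop_apply, h1, h2, Coalgebra.coassoc_apply]

lemma comulCop_counit (h : K) :
    (Coalgebra.counit (R := k)).lTensor K (comulCop k K h) = h ⊗ₜ 1 := by
  have h1 : ∀ z : K ⊗[k] K, (Coalgebra.counit (R := k)).lTensor K (TensorProduct.comm k K K z) =
      TensorProduct.comm k k K ((Coalgebra.counit (R := k)).rTensor K z) := by
    intro z
    induction z with
    | zero => simp
    | add x y hx hy => simp only [map_add, hx, hy]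
    | tmul a b => simp
  rw [comulCop_apply, h1, Coalgebra.rTensor_counit_comul, TensorProduct.comm_tmul]

lemma twist_comulCop_bijective
    (hS : Function.Bijective (HopfAlgebra.antipode (R := k) (A := K))) :
    Function.Bijective (twist (comulCop k K) LinearMap.id : K ⊗[k] N →ₗ[k] K ⊗[k] N) := by
  let e := LinearEquiv.ofBijective _ hS
  have he : ∀ x, HopfAlgebra.antipode k (e.symm x) = x := e.apply_symm_apply
  refine twist_bijective _ comulCop_coassoc Coalgebra.counit comulCop_counit e.symm.toLinearMap
    ?_ ?_
  · ext h
    apply hS.1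
    have h1 : ∀ z : K ⊗[k] K, HopfAlgebra.antipode k (LinearMap.mul' k K
        (e.symm.toLinearMap.rTensor K (TensorProduct.comm k K K z))) =
        LinearMap.mul' k K ((HopfAlgebra.antipode k).rTensor K z) := by
      intro z
      induction z with
      | zero => simp
      | add x y hx hy => simp only [map_add, hx, hy]
      | tmul a b => simp [HopfAlgebra.antipode_mul_antidistrib, he]
    simp only [LinearMap.comp_apply, comulCop_apply, h1,
      HopfAlgebra.mul_antipode_rTensor_comul_apply]
    simp [Algebra.algebraMap_eq_smul_one]
  · ext h
    apply hS.1
    have h1 : ∀ z : K ⊗[k] K, HopfAlgebra.antipode k (LinearMap.mul' k K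
        (e.symm.toLinearMap.lTensor K (TensorProduct.comm k K K z))) =
        LinearMap.mul' k K ((HopfAlgebra.antipode k).lTensor K z) := by
      intro z
      induction z with
      | zero => simp
      | add x y hx hy => simp only [map_add, hx, hy]
      | tmul a b => simp [HopfAlgebra.antipode_mul_antidistrib, he]
    simp only [LinearMap.comp_apply, comulCop_apply, h1,
      HopfAlgebra.mul_antipode_lTensor_comul_apply]
    simp [Algebra.algebraMap_eq_smul_one]

end HopfTwist

section DiagonalAction

/-- The tensor product `M ⊗[k] N`, as a type carrying the diagonal `K`-module structure. -/
def DiagTensor (k : Type u) [CommRing k] (M N : Type u) [AddCommGroup M] [Module k M]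
    [AddCommGroup N] [Module k N] : Type u :=
  M ⊗[k] N

namespace DiagTensor

section

variable (k : Type u) [CommRing k] (M N : Type u) [AddCommGroup M] [Module k M] [AddCommGroup N]
  [Module k N]

instance : AddCommGroup (DiagTensor k M N) := inferInstanceAs (AddCommGroup (M ⊗[k] N))

instance : Module k (DiagTensor k M N) := inferInstanceAs (Module k (M ⊗[k] N))

/-- The identity map, as a linear equivalence onto the type synonym. -/
def of : M ⊗[k] N ≃ₗ[k] DiagTensor k M N := LinearEquiv.refl k (M ⊗[k] N)

end

variable {k K : Type u} [CommRing k] [Ring K] [HopfAlgebra k K]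
variable {M N M' N' V : Type u}
  [AddCommGroup M] [Module k M] [Module K M] [IsScalarTower k K M]
  [AddCommGroup N] [Module k N] [Module K N] [IsScalarTower k K N]
  [AddCommGroup M'] [Module k M'] [Module K M'] [IsScalarTower k K M']
  [AddCommGroup N'] [Module k N'] [Module K N'] [IsScalarTower k K N']
  [AddCommGroup V] [Module k V]

variable (M N) in
/-- The componentwise action of `K ⊗[k] K` on `M ⊗[k] N`. -/
def act : K ⊗[k] K →ₐ[k] Module.End k (M ⊗[k] N) :=
  Module.endTensorEndAlgHom.comp (Algebra.TensorProduct.map (Algebra.lsmul k k M)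
    (Algebra.lsmul k k N))

lemma act_tmul_tmul (a b : K) (m : M) (n : N) :
    act M N (a ⊗ₜ[k] b) (m ⊗ₜ[k] n) = (a • m) ⊗ₜ[k] (b • n) := rfl

instance (priority := 100) : Module K (DiagTensor k M N) :=
  haveI : SMulCommClass k K M := IsScalarTower.to_smulCommClass
  haveI : SMulCommClass k K N := IsScalarTower.to_smulCommClass
  tensorModule k K M N

lemma smul_of (h : K) (t : M ⊗[k] N) :
    h • of k M N t = of k M N (act M N (Coalgebra.comul (R := k) h) t) :=
  rfl

lemma act_map (f : M →ₗ[K] M') (g : N →ₗ[K] N') (z : K ⊗[k] K) (t : M ⊗[k] N) :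
    TensorProduct.map (f.restrictScalars k) (g.restrictScalars k) (act M N z t) =
      act M' N' z (TensorProduct.map (f.restrictScalars k) (g.restrictScalars k) t) := by
  induction z with
  | zero => simp
  | add z w hz hw => simp only [map_add, LinearMap.add_apply, hz, hw]
  | tmul a b =>
    induction t with
    | zero => simp
    | add x y hx hy => simp only [map_add, hx, hy]
    | tmul m n => simp [act_tmul_tmul]

variable (k) in
/-- The tensor product of two `K`-linear maps. -/
def map (f : M →ₗ[K] M') (g : N →ₗ[K] N') : DiagTensor k M N →ₗ[K] DiagTensor k M' N' where
  toFun x := of k M' N' (TensorProduct.map (f.restrictScalars k) (g.restrictScalars k)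
    ((of k M N).symm x))
  map_add' x y := by simp only [map_add]
  map_smul' h x := by
    obtain ⟨t, rfl⟩ := (of k M N).surjective x
    simp [smul_of, act_map]

lemma map_of (f : M →ₗ[K] M') (g : N →ₗ[K] N') (t : M ⊗[k] N) :
    map k f g (of k M N t) = of k M' N' (TensorProduct.map (f.restrictScalars k)
      (g.restrictScalars k) t) := rfl

lemma map_comp_map {M'' N'' : Type u} [AddCommGroup M''] [Module k M''] [Module K M'']
    [IsScalarTower k K M''] [AddCommGroup N''] [Module k N''] [Module K N''] [IsScalarTower k K N'']
    (f' : M' →ₗ[K] M'') (f : M →ₗ[K] M') (g' : N' →ₗ[K] N'') (g : N →ₗ[K] N') :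
    map k f' g' ∘ₗ map k f g = map k (f' ∘ₗ f) (g' ∘ₗ g) := by
  ext x
  obtain ⟨t, rfl⟩ := (of k M N).surjective x
  rw [LinearMap.comp_apply, map_of, map_of, map_of, ← LinearMap.comp_apply,
    ← TensorProduct.map_comp]
  rfl

lemma map_id : map k (LinearMap.id : M →ₗ[K] M) (LinearMap.id : N →ₗ[K] N) = LinearMap.id := by
  ext x
  obtain ⟨t, rfl⟩ := (of k M N).surjective x
  rw [map_of]
  exact congrArg _ (LinearMap.congr_fun TensorProduct.map_id t)

/-- `K`-linearity for maps out of a free module. -/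
lemma exists_linearEquiv {W D : Type u} [AddCommGroup W] [Module k W] [AddCommGroup D] [Module K D]
    (φ : K ⊗[k] W →+ D) (hφ : Function.Bijective φ)
    (h : ∀ (a : K) (w : W), φ (a ⊗ₜ w) = a • φ (1 ⊗ₜ w)) :
    ∃ e : K ⊗[k] W ≃ₗ[K] D, ∀ x, e x = φ x := by
  refine ⟨LinearEquiv.ofBijective { φ with map_smul' := fun a x => ?_ } hφ, fun x => rfl⟩
  change φ (a • x) = a • φ x
  induction x with
  | zero => simp
  | add x y hx hy => simp only [smul_add, map_add, hx, hy]
  | tmul b w => rw [TensorProduct.smul_tmul', smul_eq_mul, h, h b, mul_smul]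

/-- `h ⊗ (v ⊗ n) ↦ ∑ (h₁ ⊗ v) ⊗ h₂ • n` is an isomorphism from the free module. -/
lemma exists_freeLeft (V N : Type u) [AddCommGroup V] [Module k V]
    [AddCommGroup N] [Module k N] [Module K N] [IsScalarTower k K N] :
    ∃ e : K ⊗[k] (V ⊗[k] N) ≃ₗ[K] DiagTensor k (K ⊗[k] V) N,
      ∀ v n, e (1 ⊗ₜ (v ⊗ₜ n)) = of k _ _ ((1 ⊗ₜ v) ⊗ₜ n) := by
  let a : K ⊗[k] (V ⊗[k] N) ≃ₗ[k] V ⊗[k] (K ⊗[k] N) := TensorProduct.leftComm k K V N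
  let b : V ⊗[k] (K ⊗[k] N) ≃ₗ[k] (K ⊗[k] V) ⊗[k] N :=
    (TensorProduct.leftComm k V K N).trans (TensorProduct.assoc k K V N).symm
  let t : K ⊗[k] N ≃ₗ[k] K ⊗[k] N := LinearEquiv.ofBijective _ (twist_comul_bijective (k := k))
  let φ : K ⊗[k] (V ⊗[k] N) ≃ₗ[k] DiagTensor k (K ⊗[k] V) N :=
    a.trans ((t.lTensor V).trans (b.trans (of k _ _)))
  have hφ : ∀ h v n, φ (h ⊗ₜ (v ⊗ₜ n)) = h • of k (K ⊗[k] V) N ((1 ⊗ₜ v) ⊗ₜ n) := by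
    intro h v n
    rw [smul_of]
    change of k _ _ (b (v ⊗ₜ (twist Coalgebra.comul LinearMap.id (h ⊗ₜ n)))) = _
    rw [twist_tmul]
    congr 1
    induction (Coalgebra.comul (R := k) h) with
    | zero => simp
    | add x y hx hy => simp only [TensorProduct.tmul_add, map_add, LinearMap.add_apply, hx, hy]
    | tmul c d => simp [b, orbitMap_apply, act_tmul_tmul, TensorProduct.smul_tmul']
  obtain ⟨e, he⟩ := exists_linearEquiv φ.toLinearMap.toAddMonoidHom φ.bijective (by
    intro h w
    change φ _ = h • φ _
    induction w with
    | zero => simp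
    | add x y hx hy => simp only [TensorProduct.tmul_add, map_add, smul_add, hx, hy]
    | tmul v n => rw [hφ, hφ, one_smul])
  refine ⟨e, fun v n => ?_⟩
  rw [he]
  exact (hφ 1 v n).trans (one_smul _ _)

/-- `h ⊗ (m ⊗ v) ↦ ∑ h₁ • m ⊗ (h₂ ⊗ v)` is an isomorphism from the free module. -/
lemma exists_freeRight (hS : Function.Bijective (HopfAlgebra.antipode (R := k) (A := K)))
    (M V : Type u) [AddCommGroup V] [Module k V]
    [AddCommGroup M] [Module k M] [Module K M] [IsScalarTower k K M] :
    Nonempty (K ⊗[k] (M ⊗[k] V) ≃ₗ[K] DiagTensor k M (K ⊗[k] V)) := by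
  let a : K ⊗[k] (M ⊗[k] V) ≃ₗ[k] (K ⊗[k] M) ⊗[k] V := (TensorProduct.assoc k K M V).symm
  let b : (K ⊗[k] M) ⊗[k] V ≃ₗ[k] M ⊗[k] (K ⊗[k] V) :=
    (TensorProduct.assoc k K M V).trans (TensorProduct.leftComm k K M V)
  let t : K ⊗[k] M ≃ₗ[k] K ⊗[k] M := LinearEquiv.ofBijective _ (twist_comulCop_bijective hS)
  let φ : K ⊗[k] (M ⊗[k] V) ≃ₗ[k] DiagTensor k M (K ⊗[k] V) :=
    a.trans ((t.rTensor V).trans (b.trans (of k _ _)))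
  have hφ : ∀ h m v, φ (h ⊗ₜ (m ⊗ₜ v)) = h • of k M (K ⊗[k] V) (m ⊗ₜ (1 ⊗ₜ v)) := by
    intro h m v
    rw [smul_of]
    change of k _ _ (b ((twist (comulCop k K) LinearMap.id (h ⊗ₜ m)) ⊗ₜ v)) = _
    rw [twist_tmul, comulCop_apply]
    congr 1
    induction (Coalgebra.comul (R := k) h) with
    | zero => simp
    | add x y hx hy => simp only [TensorProduct.add_tmul, map_add, LinearMap.add_apply, hx, hy]
    | tmul c d => simp [b, orbitMap_apply, act_tmul_tmul, TensorProduct.smul_tmul']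
  obtain ⟨e, -⟩ := exists_linearEquiv φ.toLinearMap.toAddMonoidHom φ.bijective (by
    intro h w
    change φ _ = h • φ _
    induction w with
    | zero => simp
    | add x y hx hy => simp only [TensorProduct.tmul_add, map_add, smul_add, hx, hy]
    | tmul v n => rw [hφ, hφ, one_smul])
  exact ⟨e⟩

end DiagTensor

end DiagonalAction

section TensorFunctors

open scoped ModuleCat

variable {k K : Type u} [Field k] [Ring K] [HopfAlgebra k K]

/-- The action map `K ⊗[k] M → M`. -/
def actionMap (k K M : Type u) [Field k] [Ring K] [HopfAlgebra k K] [AddCommGroup M] [Module k M]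
    [Module K M] [IsScalarTower k K M] : K ⊗[k] M →ₗ[K] M :=
  TensorProduct.AlgebraTensorModule.lift
    { toFun := fun h => Algebra.lsmul k k M h
      map_add' := map_add _
      map_smul' := fun a b => by ext; simp }

lemma actionMap_surjective (M : Type u) [AddCommGroup M] [Module k M]
    [Module K M] [IsScalarTower k K M] : Function.Surjective (actionMap k K M) :=
  fun m => ⟨1 ⊗ₜ m, by simp [actionMap]⟩

namespace DiagTensor

variable {M N A B C : Type u}
  [AddCommGroup M] [Module k M] [Module K M] [IsScalarTower k K M]
  [AddCommGroup N] [Module k N] [Module K N] [IsScalarTower k K N]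
  [AddCommGroup A] [Module k A] [Module K A] [IsScalarTower k K A]
  [AddCommGroup B] [Module k B] [Module K B] [IsScalarTower k K B]
  [AddCommGroup C] [Module k C] [Module K C] [IsScalarTower k K C]

lemma projective_left [Module.Projective K M] : Module.Projective K (DiagTensor k M N) := by
  obtain ⟨s, hs⟩ := Module.projective_lifting_property (actionMap k K M) LinearMap.id
    (actionMap_surjective M)
  obtain ⟨e, -⟩ := exists_freeLeft (k := k) (K := K) M N
  have := Module.Projective.of_equiv e
  refine Module.Projective.of_split (map k s (LinearMap.id : N →ₗ[K] N))
    (map k (actionMap k K M) LinearMap.id) ?_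
  rw [map_comp_map, hs, LinearMap.id_comp, map_id]

lemma projective_right (hS : Function.Bijective (HopfAlgebra.antipode (R := k) (A := K)))
    [Module.Projective K N] : Module.Projective K (DiagTensor k M N) := by
  obtain ⟨s, hs⟩ := Module.projective_lifting_property (actionMap k K N) LinearMap.id
    (actionMap_surjective N)
  obtain ⟨e⟩ := exists_freeRight hS M N
  have := Module.Projective.of_equiv e
  refine Module.Projective.of_split (map k (LinearMap.id : M →ₗ[K] M) s)
    (map k LinearMap.id (actionMap k K N)) ?_
  rw [map_comp_map, hs, LinearMap.id_comp, map_id]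

lemma isShortExactPair_left {i : A →ₗ[K] B} {p : B →ₗ[K] C} (h : IsShortExactPair i p) :
    IsShortExactPair (map k i (LinearMap.id : N →ₗ[K] N)) (map k p LinearMap.id) :=
  ⟨Module.Flat.rTensor_preserves_injective_linearMap (M := N) (i.restrictScalars k) h.inj,
    rTensor_exact (f := i.restrictScalars k) (g := p.restrictScalars k) N h.exact h.surj,
    LinearMap.rTensor_surjective N (g := p.restrictScalars k) h.surj⟩

lemma isShortExactPair_right {i : A →ₗ[K] B} {p : B →ₗ[K] C} (h : IsShortExactPair i p) :
    IsShortExactPair (map k (LinearMap.id : M →ₗ[K] M) i) (map k LinearMap.id p) :=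
  ⟨Module.Flat.lTensor_preserves_injective_linearMap (M := M) (i.restrictScalars k) h.inj,
    lTensor_exact (f := i.restrictScalars k) (g := p.restrictScalars k) M h.exact h.surj,
    LinearMap.lTensor_surjective M (g := p.restrictScalars k) h.surj⟩

/-- The embedding `x ↦ x ⊗ l` defined by an invariant element `l`. -/
def inclusion (M : Type u) [AddCommGroup M] [Module k M] [Module K M] [IsScalarTower k K M]
    (l : N) (hl : ∀ h : K, h • l = Coalgebra.counit (R := k) h • l) :
    M →ₗ[K] DiagTensor k M N where
  toFun x := of k M N (x ⊗ₜ l)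
  map_add' x y := by rw [TensorProduct.add_tmul, map_add]
  map_smul' h x := by
    rw [RingHom.id_apply, smul_of]
    congr 1
    have key : ∀ z : K ⊗[k] K, act M N z (x ⊗ₜ l) = TensorProduct.lift
        ((LinearMap.lsmul k M).flip.compl₂ Coalgebra.counit) ((orbitMap x).rTensor K z) ⊗ₜ[k] l := by
      intro z
      induction z with
      | zero => simp
      | add x y hx hy => simp only [map_add, LinearMap.add_apply, TensorProduct.add_tmul, hx, hy]
      | tmul a b => simp [act_tmul_tmul, hl, orbitMap_apply, TensorProduct.smul_tmul']
    have h2 : ∀ z : K ⊗[k] K, TensorProduct.lift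
        ((LinearMap.lsmul k M).flip.compl₂ Coalgebra.counit) ((orbitMap x).rTensor K z) =
        TensorProduct.lift ((LinearMap.lsmul k M).flip)
          ((orbitMap x).rTensor k (Coalgebra.counit.lTensor K z)) := by
      intro z
      induction z with
      | zero => simp
      | add x y hx hy => simp only [map_add, hx, hy]
      | tmul a b => simp
    rw [key, h2, Coalgebra.lTensor_counit_comul]
    simp [orbitMap_apply]

lemma map_inclusion (f : A →ₗ[K] B) (l : N)
    (hl : ∀ h : K, h • l = Coalgebra.counit (R := k) h • l) :
    map k f LinearMap.id ∘ₗ inclusion A l hl = inclusion B l hl ∘ₗ f := rfl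

lemma inclusion_injective (l : N) (hl : ∀ h : K, h • l = Coalgebra.counit (R := k) h • l)
    (h0 : l ≠ 0) : Function.Injective (inclusion M l hl) := by
  obtain ⟨φ, hφ⟩ := Module.Projective.exists_dual_ne_zero k h0
  have : Function.LeftInverse (fun x => (φ l)⁻¹ • TensorProduct.rid k M
      (φ.lTensor M ((of k M N).symm x))) (inclusion M l hl) := by
    intro x
    simp [inclusion, smul_smul, hφ]
  exact this.injective

lemma exists_retraction_free (V : Type u) [AddCommGroup V] [Module k V] (l : N)
    (hl : ∀ h : K, h • l = Coalgebra.counit (R := k) h • l) (h0 : l ≠ 0) :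
    ∃ r : DiagTensor k (K ⊗[k] V) N →ₗ[K] K ⊗[k] V,
      r ∘ₗ inclusion (K ⊗[k] V) l hl = LinearMap.id := by
  obtain ⟨φ, hφ⟩ := Module.Projective.exists_dual_ne_zero k h0
  obtain ⟨e, he⟩ := exists_freeLeft (k := k) (K := K) V N
  let ψ : V ⊗[k] N →ₗ[k] V := (φ l)⁻¹ • (TensorProduct.rid k V).toLinearMap ∘ₗ φ.lTensor V
  refine ⟨TensorProduct.AlgebraTensorModule.map LinearMap.id ψ ∘ₗ e.symm.toLinearMap, ?_⟩
  ext v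
  have : inclusion (K ⊗[k] V) l hl (1 ⊗ₜ v) = e (1 ⊗ₜ (v ⊗ₜ l)) := (he v l).symm
  simp [this, ψ, smul_smul, hφ]

lemma exists_retraction [Module.Projective K M] (l : N)
    (hl : ∀ h : K, h • l = Coalgebra.counit (R := k) h • l) (h0 : l ≠ 0) :
    ∃ r : DiagTensor k M N →ₗ[K] M, r ∘ₗ inclusion M l hl = LinearMap.id := by
  obtain ⟨s, hs⟩ := Module.projective_lifting_property (actionMap k K M) LinearMap.id
    (actionMap_surjective M)
  obtain ⟨r, hr⟩ := exists_retraction_free (K := K) M l hl h0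
  refine ⟨actionMap k K M ∘ₗ r ∘ₗ map k s LinearMap.id, ?_⟩
  rw [LinearMap.comp_assoc, LinearMap.comp_assoc, map_inclusion, ← LinearMap.comp_assoc _ _ r, hr,
    LinearMap.id_comp, hs]

variable (k) in
/-- The functor `X ↦ X ⊗ N`. -/
def tensorRight (N : ModuleCat.{u} K) : ModuleCat.{u} K ⥤ ModuleCat.{u} K where
  obj X := ModuleCat.of K (DiagTensor k X N)
  map f := ModuleCat.ofHom (map k f.hom LinearMap.id)
  map_id X := congrArg ModuleCat.ofHom map_id
  map_comp f g := by
    rw [← ModuleCat.ofHom_comp, map_comp_map]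

variable (k) in
/-- The functor `N ↦ X ⊗ N`. -/
def tensorLeft (X : ModuleCat.{u} K) : ModuleCat.{u} K ⥤ ModuleCat.{u} K where
  obj N := ModuleCat.of K (DiagTensor k X N)
  map f := ModuleCat.ofHom (map k LinearMap.id f.hom)
  map_id X := congrArg ModuleCat.ofHom map_id
  map_comp f g := by
    rw [← ModuleCat.ofHom_comp, map_comp_map]

end DiagTensor

open DiagTensor

/-- Tensoring with a module of finite projective dimension that has a nonzero invariant element. -/
def FiniteProjDimEmbedding.ofInvariant
    (hS : Function.Bijective (HopfAlgebra.antipode (R := k) (A := K))) {n : ℕ}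
    (L : ModuleCat.{u} K) (hL : HasProjectiveDimensionLT L (n + 1)) (l : L)
    (hl : ∀ h : K, h • l = Coalgebra.counit (R := k) h • l) (h0 : l ≠ 0) :
    FiniteProjDimEmbedding K n where
  T := tensorRight k L
  η := { app := fun X => ModuleCat.ofHom (inclusion X l hl) }
  exact i p h := isShortExactPair_left h
  injective X := inclusion_injective l hl h0
  projective Q _ := projective_left (k := k) (M := Q) (N := L)
  retraction Q _ := by
    obtain ⟨r, hr⟩ := exists_retraction (M := Q) l hl h0
    exact ⟨ModuleCat.ofHom r, ModuleCat.hom_ext hr⟩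
  projDim X := hasProjectiveDimensionLT_obj (tensorLeft k X)
    (fun i p h => isShortExactPair_right h)
    (fun P _ => projective_right (k := k) (M := X) (N := P) hS) n L hL

theorem gProjDimLE_of_hopf_subalgebra {H : Type u} [Ring H] [HopfAlgebra k H]
    (hSK : Function.Bijective (HopfAlgebra.antipode (R := k) (A := K)))
    (f : K →ₐc[k] H)
    (hproj : @Module.Projective K _ H _ (Module.compHom H (f : K →+* H))) {n : ℕ}
    (h : GProjDimLE H n (trivMod k H)) (M : ModuleCat.{u} K) : GProjDimLE K n M := by
  obtain ⟨L, C, i, p, hip, hL, -⟩ := h.exists_embedding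
  let L' := (ModuleCat.restrictScalars (f : K →+* H)).obj L
  have hL' : HasProjectiveDimensionLT L' (n + 1) :=
    hasProjectiveDimensionLT_obj (ModuleCat.restrictScalars (f : K →+* H))
      (fun i p h => ⟨h.inj, h.exact, h.surj⟩) (projective_restrictScalars _ hproj) n L hL
  let l : L' := i (1 : k)
  have h0 : l ≠ 0 := fun h0 => one_ne_zero (α := k) (hip.inj (h0.trans (map_zero i).symm))
  have hl : ∀ h : K, h • l = Coalgebra.counit (R := k) h • l := by
    intro h
    have h1 : ∀ c : k, f (algebraMap k K c) = algebraMap k H c := fun c =>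
      AlgHomClass.commutes f c
    have h2 : ∀ a : H, a • (i (1 : k) : L) = i (Coalgebra.counit (R := k) a : k) := fun a =>
      (i.map_smul a _).symm.trans (congrArg i (mul_one (Coalgebra.counit (R := k) a)))
    change f h • (i (1 : k) : L) = f (algebraMap k K (Coalgebra.counit h)) • (i (1 : k) : L)
    rw [h2, h2, h1]
    simp
  exact (FiniteProjDimEmbedding.ofInvariant hSK L' hL' l hl h0).gProjDimLE M

end TensorFunctors

end HopfSubalgebra

/-- Let `H` be a Hopf algebra over a field `k` with bijective antipode and
let `K ⊆ H` be a Hopf subalgebra (given by an injective bialgebra morphism `f : K → H`) with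
bijective antipode, such that `H` is projective as a left `K`-module. Then
`Gpd_K(εk) ≤ Gpd_H(εk)`, equivalently `l.Ggldim(K) ≤ l.Ggldim(H)`. -/
theorem gProjDim_trivial_le_of_hopf_subalgebra (k : Type u) [Field k]
    (H K : Type u) [Ring H] [HopfAlgebra k H] [Ring K] [HopfAlgebra k K]
    (hSH : Function.Bijective (HopfAlgebra.antipode (R := k) (A := H)))
    (hSK : Function.Bijective (HopfAlgebra.antipode (R := k) (A := K)))
    (f : K →ₐc[k] H) (hf : Function.Injective f)
    (hproj : @Module.Projective K _ H _ (Module.compHom H (f : K →+* H))) :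
    gProjDim K (trivMod k K) ≤ gProjDim H (trivMod k H) ∧ lGgldim K ≤ lGgldim H := by
  have key : ∀ M : ModuleCat.{u} K, gProjDim K M ≤ gProjDim H (trivMod k H) := by
    refine fun M => le_sInf ?_
    rintro _ ⟨m, rfl, hm⟩
    exact sInf_le ⟨m, rfl, gProjDimLE_of_hopf_subalgebra hSK f hproj hm M⟩
  exact ⟨key _, (iSup_le key).trans
    (le_iSup (fun M : ModuleCat.{u} H => gProjDim H M) (trivMod k H))⟩
end
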